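/- arXiv:1512.09249 — 3 statements merged into one kernel-verified Lean document; each statement's English description precedes it below -/
import Mathlib

section
/- Let p be an odd prime, k₁, k₂ ∈ ℕ, and α, β ∈ ℤ with β ≠ 0. Set K = k₁ + 2k₂ and w = min(v_p(β), K). Define τ as follows: if v_p(α) < w (with v_p(0) = ∞) then τ = 0; otherwise, writing δ = gcd(α,β), α₀ = α/δ, β₀ = β/δ, and choosing an integer q with β₀·q ≡ 1 (mod p^{K−w}), set τ = p^{(K+w)/2} · η(p^{K−w}) · ((β/p^w) | p^{K−w}) · e(−β·(α₀·q)²/p^K) (this is independent of the choice of q). Then ω_{p^{k₁},p^{k₂}}(α, β) = τ · c, where c = φ(p^{k₁}) if v_p(β) ≥ k₁ and k₁ is even; c = −p^{k₁−1} if v_p(β) = k₁−1 and k₁ is even; c = ((−β/p^{k₁−1}) | p) · η(p) · p^{k₁−1/2} if v_p(β) = k₁−1 and k₁ is odd; and c = 0 otherwise. -/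
/-- `e(t) = e^{2πit}`. -/
noncomputable def e2 (t : ℝ) : ℂ := Complex.exp (2 * Real.pi * Complex.I * t)

/-- `η(n)` is the complex conjugate of `(1 + i^n)/(1 + i)`. -/
noncomputable def eta (n : ℕ) : ℂ :=
  starRingEnd ℂ ((1 + Complex.I ^ n) / (1 + Complex.I))

/-- The character sum
`ω_{p^{k₁},p^{k₂}}(α, β) = ∑_{a, b mod p^{k₁+2k₂}, a² ≡ b (p^{2k₂})}
(((a²−b)/p^{2k₂}) | p^{k₁}) · e((2aα + bβ)/p^{k₁+2k₂})`. -/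
noncomputable def omegaSum (p k₁ k₂ : ℕ) (α β : ℤ) : ℂ :=
  ∑ a ∈ Finset.range (p ^ (k₁ + 2 * k₂)), ∑ b ∈ Finset.range (p ^ (k₁ + 2 * k₂)),
    if (p : ℤ) ^ (2 * k₂) ∣ ((a : ℤ) ^ 2 - (b : ℤ)) then
      ((jacobiSym (((a : ℤ) ^ 2 - (b : ℤ)) / (p : ℤ) ^ (2 * k₂)) (p ^ k₁) : ℤ) : ℂ) *
        e2 (((2 * a * α + b * β : ℤ) : ℝ) / (p : ℝ) ^ (k₁ + 2 * k₂))
    else 0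

section Analytic
open Filter Topology
open Complex hiding eta

lemma ofReal_mul_cpow (r : ℝ) (hr : 0 < r) (z : ℂ) (hz : z ≠ 0) (s : ℂ) :
    ((r : ℂ) * z) ^ s = (r : ℂ) ^ s * z ^ s := by
  have hr' : (r : ℂ) ≠ 0 := by exact_mod_cast hr.ne'
  rw [Complex.cpow_def_of_ne_zero (mul_ne_zero hr' hz), Complex.cpow_def_of_ne_zero hr',
    Complex.cpow_def_of_ne_zero hz, Complex.log_ofReal_mul hr hz, ← Complex.exp_add,
    ← Complex.ofReal_log hr.le, add_mul]

lemma sq_cpow_half (r : ℝ) (hr : 0 < r) : ((r : ℂ) ^ 2) ^ (1 / 2 : ℂ) = r := by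
  have := Complex.ofReal_cpow (x := r ^ 2) (by positivity) (1 / 2 : ℝ)
  push_cast at this
  rw [← this]
  norm_cast
  rw [← Real.sqrt_eq_rpow, Real.sqrt_sq hr.le]

lemma summable_gauss (z : ℂ) (hz : 0 < z.re) :
    Summable (fun n : ℤ => cexp (-Real.pi * z * n ^ 2)) := by
  have := (summable_jacobiTheta₂_term_iff 0 (I * z)).2 (by simpa using hz)
  refine this.congr fun n => ?_
  simp only [jacobiTheta₂_term]
  congr 1
  linear_combination (Real.pi * n ^ 2 * z) * Complex.I_sq

lemma theta_tail (θ : ℝ) {l : Filter ℝ} (w : ℝ → ℂ)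
    (hw : Tendsto (fun t => (w t).re) l atTop) :
    Tendsto (fun t => ∑' n : ℤ, cexp (-Real.pi * w t * n ^ 2 + θ * n * I)) l (𝓝 1) := by
  have h1 : (∑' n : ℤ, if n = 0 then (1 : ℂ) else 0) = 1 := by
    rw [tsum_ite_eq]
  rw [← h1]
  have hn : ∀ t (n : ℤ), ‖cexp (-Real.pi * w t * n ^ 2 + θ * n * I)‖
      = Real.exp (-Real.pi * (w t).re * n ^ 2) := by
    intro t n
    rw [Complex.norm_exp]
    congr 1
    have : (-(Real.pi : ℂ) * w t * n ^ 2 + θ * n * I)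
      = ((-Real.pi * n ^ 2 : ℝ) : ℂ) * w t + ((θ * n : ℝ) : ℂ) * I := by push_cast; ring
    rw [this, Complex.add_re, Complex.re_ofReal_mul, Complex.re_ofReal_mul]
    simp; ring
  have hs : Summable (fun n : ℤ => Real.exp (-Real.pi * n ^ 2)) := by
    have := (summable_gauss 1 (by simp)).norm
    refine this.congr fun n => ?_
    rw [Complex.norm_exp]
    congr 1
    have : (-(Real.pi : ℂ) * 1 * n ^ 2) = ((-Real.pi * n ^ 2 : ℝ) : ℂ) := by push_cast; ring
    rw [this, Complex.ofReal_re]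
  refine tendsto_tsum_of_dominated_convergence hs ?_ ?_
  · intro n
    by_cases h : n = 0
    · simpa [h] using tendsto_const_nhds
    · rw [if_neg h, tendsto_zero_iff_norm_tendsto_zero]
      simp_rw [hn]
      refine Real.tendsto_exp_atBot.comp ?_
      have hpos : 0 < Real.pi * (n : ℝ) ^ 2 := by positivity
      have := (hw.const_mul_atTop hpos)
      refine (tendsto_neg_atTop_atBot.comp this).congr fun t => ?_
      simp; ring
  · filter_upwards [hw.eventually_ge_atTop 1] with t ht n
    rw [hn]
    apply Real.exp_le_exp.2
    have : 0 ≤ Real.pi * (n : ℝ) ^ 2 := by positivity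
    nlinarith

lemma theta_exact (M : ℕ) (hM : 0 < M) (r : ℕ) (z : ℂ) (hz : 0 < z.re) :
    z ^ (1 / 2 : ℂ) * ∑' m : ℤ, cexp (-Real.pi * z * ((m * M + r : ℤ) : ℂ) ^ 2) =
      (1 / M) * ∑' n : ℤ, cexp (-Real.pi * (((1 / M ^ 2 : ℝ) : ℂ) * (1 / z)) * n ^ 2
        + ((2 * Real.pi * r / M : ℝ) : ℂ) * n * I) := by
  have hM' : (M : ℂ) ≠ 0 := by exact_mod_cast hM.ne'
  have hMr : (0 : ℝ) < M := by exact_mod_cast hM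
  have hz0 : z ≠ 0 := by rintro rfl; simp at hz
  have hzc : z ^ (1 / 2 : ℂ) ≠ 0 := by
    rw [Ne, Complex.cpow_eq_zero_iff]; simp [hz0]
  have ha : 0 < (((M ^ 2 : ℝ) : ℂ) * z).re := by
    rw [Complex.re_ofReal_mul]; positivity
  have key := Complex.tsum_exp_neg_quadratic ha (-(z * M * r))
  have e1 : ∀ m : ℤ, cexp (-Real.pi * z * ((m * M + r : ℤ) : ℂ) ^ 2) =
      cexp (-Real.pi * z * r ^ 2) * cexp (-Real.pi * (((M ^ 2 : ℝ) : ℂ) * z) * m ^ 2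
        + 2 * Real.pi * (-(z * M * r)) * m) := by
    intro m
    rw [← Complex.exp_add]; congr 1; push_cast; ring
  simp_rw [e1]
  rw [tsum_mul_left, key]
  have e2 : ∀ n : ℤ, cexp (-Real.pi * (((1 / M ^ 2 : ℝ) : ℂ) * (1 / z)) * n ^ 2
        + ((2 * Real.pi * r / M : ℝ) : ℂ) * n * I) = cexp (-Real.pi * z * r ^ 2) *
        cexp (-Real.pi / (((M ^ 2 : ℝ) : ℂ) * z) * (n + I * -(z * M * r)) ^ 2) := by
    intro n
    rw [← Complex.exp_add]; congr 1; push_cast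
    field_simp
    ring_nf
    simp only [Complex.I_sq]
    ring
  simp_rw [e2]
  rw [tsum_mul_left, ofReal_mul_cpow _ (by positivity) _ hz0]
  have := sq_cpow_half M hMr
  push_cast at this ⊢
  rw [this]
  field_simp

lemma theta_asym (M : ℕ) (hM : 0 < M) (h : ℤ → ℂ) (hper : ∀ n m : ℤ, h (m * M + n) = h n)
    (hb : ∀ n, ‖h n‖ ≤ 1)
    {l : Filter ℝ} (z : ℝ → ℂ) (hz : ∀ᶠ t in l, 0 < (z t).re)
    (hw : Tendsto (fun t => (1 / z t).re) l atTop) :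
    Tendsto (fun t => (z t) ^ (1 / 2 : ℂ) * ∑' n : ℤ, h n * cexp (-Real.pi * z t * n ^ 2)) l
      (𝓝 ((1 / M) * ∑ r : Fin M, h (r : ℕ))) := by
  have : NeZero M := ⟨hM.ne'⟩
  have hMr : (0 : ℝ) < M := by exact_mod_cast hM
  have h1 : Tendsto (fun t => (1 / M : ℂ) * ∑ r : Fin M, h (r : ℕ) *
      ∑' n : ℤ, cexp (-Real.pi * (((1 / M ^ 2 : ℝ) : ℂ) * (1 / z t)) * n ^ 2
        + ((2 * Real.pi * (r : ℕ) / M : ℝ) : ℂ) * n * I)) l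
      (𝓝 ((1 / M) * ∑ r : Fin M, h (r : ℕ) * 1)) := by
    refine Tendsto.const_mul _ (tendsto_finsetSum _ fun r _ => Tendsto.const_mul _ ?_)
    apply theta_tail
    simp_rw [Complex.re_ofReal_mul]
    exact hw.const_mul_atTop (by positivity)
  simp only [mul_one] at h1
  refine h1.congr' ?_
  filter_upwards [hz] with t ht
  have hs : Summable (fun n : ℤ => h n * cexp (-Real.pi * z t * n ^ 2)) := by
    refine (summable_gauss (z t) ht).norm.of_norm_bounded fun n => ?_
    rw [norm_mul]
    exact mul_le_of_le_one_left (norm_nonneg _) (hb n)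
  have hs' := ((Int.divModEquiv M).symm.summable_iff).2 hs
  have hs2 := ((Equiv.prodComm (Fin M) ℤ).summable_iff).2 hs'
  simp only [Function.comp_def] at hs2
  rw [← (Int.divModEquiv M).symm.tsum_eq, ← (Equiv.prodComm _ _).tsum_eq,
    Summable.tsum_prod hs2, tsum_fintype, Finset.mul_sum,
    Finset.mul_sum]
  refine Finset.sum_congr rfl fun r _ => ?_
  have := theta_exact M hM r (z t) ht
  rw [mul_left_comm, ← this]
  simp only [Equiv.prodComm_apply, Prod.swap, Int.divModEquiv_symm_apply, hper]
  rw [tsum_mul_left]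
  ring

lemma gauss_fin (N : ℕ) (hN : 0 < N) :
    ∑ r : Fin N, cexp (2 * Real.pi * I * (((r : ℕ) : ℤ) : ℂ) ^ 2 / N) =
      (Real.sqrt N : ℂ) * eta N := by
  have hNr : (0 : ℝ) < N := by exact_mod_cast hN
  have hNc : (N : ℂ) ≠ 0 := by exact_mod_cast hN.ne'
  have hl : ∀ᶠ t : ℝ in 𝓝[>] 0, 0 < t := self_mem_nhdsWithin
  set l : Filter ℝ := 𝓝[>] 0 with hl0
  have htinv : Tendsto (fun t : ℝ => t⁻¹) l atTop := tendsto_inv_nhdsGT_zero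
  -- first side
  have h1 := theta_asym N hN (fun n : ℤ => cexp (2 * Real.pi * I * (n : ℂ) ^ 2 / N)) (by
      intro n m
      refine Complex.exp_eq_exp_iff_exists_int.2 ⟨m * m * N + 2 * m * n, ?_⟩
      push_cast
      field_simp
      ring) (by
      intro n
      have : (2 * Real.pi * I * (n : ℂ) ^ 2 / N) = ((2 * Real.pi * n ^ 2 / N : ℝ) : ℂ) * I := by
        push_cast; ring
      rw [this, Complex.norm_exp_ofReal_mul_I]) (l := l) (fun t => (t : ℂ)) (by
      filter_upwards [hl] with t ht
      simpa using ht) (by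
      refine htinv.congr fun t => ?_
      rw [one_div, ← Complex.ofReal_inv, Complex.ofReal_re])
  set z : ℝ → ℂ := fun t => (((4 / N ^ 2 * t⁻¹ : ℝ) : ℂ) + ((2 / N : ℝ) : ℂ) * I)⁻¹ with hz
  have hzre : ∀ t, (1 / z t).re = 4 / N ^ 2 * t⁻¹ := by
    intro t
    rw [hz]
    simp only [one_div, inv_inv]
    rw [Complex.add_re, Complex.ofReal_re, Complex.re_ofReal_mul]
    simp
  have h2 := theta_asym 2 two_pos (fun n : ℤ => cexp (-Real.pi * I * N / 2 * (n : ℂ) ^ 2)) (by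
      intro n m
      refine Complex.exp_eq_exp_iff_exists_int.2 ⟨-(N * (m * m + m * n)), ?_⟩
      push_cast
      ring) (by
      intro n
      have : (-Real.pi * I * N / 2 * (n : ℂ) ^ 2)
          = ((-Real.pi * N / 2 * n ^ 2 : ℝ) : ℂ) * I := by
        push_cast; ring
      rw [this, Complex.norm_exp_ofReal_mul_I]) (l := l) z (by
      filter_upwards [hl] with t ht
      rw [hz]
      simp only
      rw [Complex.inv_re]
      have h0 : (((4 / N ^ 2 * t⁻¹ : ℝ) : ℂ) + ((2 / N : ℝ) : ℂ) * I).re = 4 / N ^ 2 * t⁻¹ := by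
        rw [Complex.add_re, Complex.ofReal_re, Complex.re_ofReal_mul]
        simp
      have h3 : 0 < (((4 / N ^ 2 * t⁻¹ : ℝ) : ℂ) + ((2 / N : ℝ) : ℂ) * I).re := by
        rw [h0]; positivity
      refine div_pos h3 (Complex.normSq_pos.2 ?_)
      intro h4
      rw [h4] at h3
      simp at h3) (by
      simp_rw [hzre]
      exact htinv.const_mul_atTop (by positivity))
  set u : ℝ → ℂ := fun t => (((4 / N ^ 2 : ℝ) : ℂ) + ((2 / N * t : ℝ) : ℂ) * I)⁻¹ with hu
  set a : ℝ → ℂ := fun t => (t : ℂ) + ((-2 / N : ℝ) : ℂ) * I with ha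
  have hid : Tendsto (fun t : ℝ => t) l (𝓝 0) := tendsto_id.mono_left nhdsWithin_le_nhds
  have hulim : Tendsto u l (𝓝 (((N ^ 2 / 4 : ℝ) : ℂ))) := by
    have hc : ContinuousAt u 0 := by
      refine ContinuousAt.inv₀ (by fun_prop) ?_
      simp [hNc]
    have := hc.tendsto.comp hid
    have h0 : u 0 = ((N ^ 2 / 4 : ℝ) : ℂ) := by
      simp [hu]
    rw [h0] at this
    exact this
  have halim : Tendsto a l (𝓝 (((-2 / N : ℝ) : ℂ) * I)) := by
    have hc : ContinuousAt a 0 := by fun_prop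
    have := hc.tendsto.comp hid
    have h0 : a 0 = ((-2 / N : ℝ) : ℂ) * I := by simp [ha]
    rw [h0] at this
    exact this
  have hsq : ((-2 / N : ℝ) : ℂ) * I = ((((1 / Real.sqrt N : ℝ) : ℂ) * (1 - I)) ^ 2) := by
    rw [mul_pow, ← Complex.ofReal_pow, div_pow, Real.sq_sqrt hNr.le]
    push_cast
    linear_combination (-1 / (N : ℂ)) * Complex.I_sq
  have hac : Tendsto (fun t => a t ^ (1 / 2 : ℂ)) l (𝓝 (((1 / Real.sqrt N : ℝ) : ℂ) * (1 - I))) := by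
    have h0 : (((-2 / N : ℝ) : ℂ) * I) ^ (1 / 2 : ℂ) = ((1 / Real.sqrt N : ℝ) : ℂ) * (1 - I) := by
      rw [hsq, one_div (2 : ℂ), Complex.sq_cpow_two_inv]
      rw [Complex.re_ofReal_mul]
      simp [hN]
    rw [← h0]
    refine (continuousAt_cpow_const ?_).tendsto.comp halim
    right
    rw [Complex.im_ofReal_mul]
    simp [hN.ne']
  have huc : Tendsto (fun t => u t ^ (1 / 2 : ℂ)) l (𝓝 ((N / 2 : ℝ) : ℂ)) := by
    have h0 : (((N ^ 2 / 4 : ℝ) : ℂ)) ^ (1 / 2 : ℂ) = ((N / 2 : ℝ) : ℂ) := by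
      have : (((N ^ 2 / 4 : ℝ) : ℂ)) = (((N / 2 : ℝ) : ℂ)) ^ 2 := by push_cast; ring
      rw [this, sq_cpow_half _ (by positivity)]
    rw [← h0]
    refine (continuousAt_cpow_const ?_).tendsto.comp hulim
    left
    rw [Complex.ofReal_re]; positivity
  have hsN : ((Real.sqrt N : ℝ) : ℂ) ≠ 0 := by
    exact_mod_cast (Real.sqrt_pos.2 hNr).ne'
  have h1I : (1 - I : ℂ) ≠ 0 := by
    intro h; have := congrArg Complex.re h; simp at this
  have h3 := ((hac.mul huc).inv₀ (by
    push_cast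
    refine mul_ne_zero (mul_ne_zero ?_ h1I) ?_
    · simpa using hN.ne'
    · simpa using hN.ne')).mul h2
  have h4 := tendsto_nhds_unique (h1.congr' ?_) h3
  · rw [Fin.sum_univ_two] at h4
    have hE : cexp (-Real.pi * I * N / 2) = (-I) ^ N := by
      have : cexp (-Real.pi / 2 * I) = -I := by
        rw [neg_div, neg_mul, Complex.exp_neg, Complex.exp_pi_div_two_mul_I, Complex.inv_I]
      rw [← this, ← Complex.exp_nat_mul]
      congr 1; ring
    have heta : eta N = (1 + (-I) ^ N) / (1 - I) := by
      simp [eta, sub_eq_add_neg]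
    rw [heta]
    simp only [Fin.val_zero, Fin.val_one, Nat.cast_zero, Nat.cast_one, Int.cast_zero,
      Int.cast_one, one_pow, mul_one, hE] at h4
    have h5 : (cexp (-Real.pi * I * N / 2 * 0 ^ 2)) = 1 := by simp
    rw [h5] at h4
    push_cast at h4
    have h6 := congrArg (fun x => (N : ℂ) * x) h4
    simp only [← mul_assoc, mul_one_div_cancel hNc, one_mul] at h6
    push_cast
    rw [h6]
    field_simp
  · filter_upwards [hl] with t ht
    have ht' : (t : ℂ) ≠ 0 := by exact_mod_cast ht.ne'
    have hare : 0 < (a t).re := by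
      rw [ha]; simp only
      rw [Complex.add_re, Complex.ofReal_re, Complex.re_ofReal_mul]
      simpa using ht
    have ha0 : a t ≠ 0 := by intro h; rw [h] at hare; simp at hare
    have key := Complex.tsum_exp_neg_quadratic hare 0
    have hu0 : u t ≠ 0 := by
      refine inv_ne_zero ?_
      intro h
      have := congrArg Complex.re h
      rw [Complex.add_re, Complex.ofReal_re, Complex.re_ofReal_mul] at this
      simp [hN.ne'] at this
    have hzu : z t = t * u t := by
      rw [hz, hu]
      simp only
      rw [← inv_inv (t : ℂ), ← mul_inv]
      congr 1
      push_cast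
      field_simp
    have hau : u t * a t = -I * N / 2 := by
      have : a t = (-2 * I / N) * (N ^ 2 / 4 * (u t)⁻¹) := by
        simp only [ha, hu, inv_inv]
        push_cast
        field_simp
        linear_combination (4 * t * N) * Complex.I_sq
      rw [this]
      field_simp
      ring
    have haz : 1 / a t = z t + I * N / 2 := by
      rw [hzu]
      have : t = a t + 2 / N * I := by simp only [ha]; push_cast; ring
      rw [div_eq_iff ha0]
      have h7 : (t * u t + I * N / 2) * a t = t * (u t * a t) + I * N / 2 * a t := by ring
      rw [h7, hau, this]
      field_simp
      linear_combination 2 * Complex.I_sq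
    have L : ∑' n : ℤ, cexp (2 * Real.pi * I * (n : ℂ) ^ 2 / N) * cexp (-Real.pi * t * n ^ 2)
        = ∑' n : ℤ, cexp (-Real.pi * a t * n ^ 2 + 2 * Real.pi * 0 * n) := by
      refine tsum_congr fun n => ?_
      rw [← Complex.exp_add]; congr 1
      simp only [ha]; push_cast; ring
    have R : ∑' n : ℤ, cexp (-Real.pi * I * N / 2 * (n : ℂ) ^ 2) * cexp (-Real.pi * z t * n ^ 2)
        = ∑' n : ℤ, cexp (-Real.pi / a t * (n + I * 0) ^ 2) := by
      refine tsum_congr fun n => ?_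
      rw [← Complex.exp_add]; congr 1
      rw [div_eq_mul_one_div _ (a t), haz]
      ring
    rw [L, R, key, hzu, ofReal_mul_cpow t ht _ hu0]
    have huc0 : u t ^ (1 / 2 : ℂ) ≠ 0 := by
      rw [Ne, Complex.cpow_eq_zero_iff]; simp [hu0]
    have hac0 : a t ^ (1 / 2 : ℂ) ≠ 0 := by
      rw [Ne, Complex.cpow_eq_zero_iff]; simp [ha0]
    field_simp

lemma gauss_range (N : ℕ) (hN : 0 < N) :
    ∑ r ∈ Finset.range N, e2 ((((r : ℤ) ^ 2 : ℤ) : ℝ) / N) = (Real.sqrt N : ℂ) * eta N := by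
  rw [← gauss_fin N hN, Finset.sum_range]
  refine Finset.sum_congr rfl fun r _ => ?_
  rw [e2]; congr 1; push_cast; ring

end Analytic

section Algebraic
open Finset

noncomputable def EE (N : ℕ) (x : ℤ) : ℂ := e2 ((x : ℝ) / N)

lemma EE_add (N : ℕ) (x y : ℤ) : EE N (x + y) = EE N x * EE N y := by
  simp only [EE, e2]
  rw [← Complex.exp_add]; congr 1; push_cast; ring

lemma EE_zero (N : ℕ) : EE N 0 = 1 := by simp [EE, e2]

lemma EE_std (N : ℕ) [NeZero N] (x : ℤ) : EE N x = ZMod.stdAddChar (x : ZMod N) := by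
  rw [ZMod.stdAddChar_coe, EE, e2]; congr 1; push_cast; ring

lemma EE_congr (N : ℕ) (hN : N ≠ 0) {x y : ℤ} (h : (N : ℤ) ∣ x - y) : EE N x = EE N y := by
  have : NeZero N := ⟨hN⟩
  rw [EE_std, EE_std, (ZMod.intCast_eq_intCast_iff_dvd_sub y x N).2 h]

lemma EE_eq_one (N : ℕ) (hN : N ≠ 0) {x : ℤ} (h : EE N x = 1) : (N : ℤ) ∣ x := by
  have : NeZero N := ⟨hN⟩
  rw [EE_std] at h
  rw [← ZMod.intCast_zmod_eq_zero_iff_dvd]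
  apply ZMod.injective_stdAddChar
  simpa using h

lemma EE_cancel (N M : ℕ) (hM : M ≠ 0) (x : ℤ) : EE (N * M) (M * x) = EE N x := by
  rw [EE, EE]; congr 1
  push_cast
  have : (M : ℝ) ≠ 0 := by exact_mod_cast hM
  rw [mul_comm (N : ℝ), mul_div_mul_left _ _ this]

lemma sum_split (M L : ℕ) (f : ℕ → ℂ) :
    ∑ a ∈ range (M * L), f a = ∑ v ∈ range L, ∑ u ∈ range M, f (u + M * v) := by
  induction L with
  | zero => simp
  | succ L ih =>
    rw [Nat.mul_succ, sum_range_add, ih, sum_range_succ]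
    congr 1
    exact sum_congr rfl fun u _ => by rw [add_comm]

lemma sum_dvd (M L : ℕ) (hM : M ≠ 0) (f : ℤ → ℂ) :
    (∑ c ∈ range (M * L), if (M : ℤ) ∣ (c : ℤ) then f c else 0) =
      ∑ t ∈ range L, f (M * t) := by
  rw [sum_split]
  refine sum_congr rfl fun t _ => ?_
  rw [sum_eq_single 0]
  · simp
  · intro b hb hb0
    rw [if_neg]
    rw [Int.natCast_dvd_natCast, Nat.dvd_add_left (Dvd.intro _ rfl)]
    exact fun h => absurd (Nat.le_of_dvd (Nat.pos_of_ne_zero hb0) h) (by simpa using hb)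
  · intro h; simp at h; exact absurd h hM

lemma sum_zmod (N : ℕ) [NeZero N] (F : ZMod N → ℂ) :
    ∑ a ∈ range N, F ((a : ℤ) : ZMod N) = ∑ x, F x := by
  refine sum_bij' (fun a _ => ((a : ℤ) : ZMod N)) (fun x _ => x.val) ?_ ?_ ?_ ?_ ?_
  · simp
  · intro x _; simpa using ZMod.val_lt x
  · intro a ha; simp at ha; simp [ZMod.val_natCast, Nat.mod_eq_of_lt ha]
  · intro x _; simp
  · simp

lemma sum_periodic (N : ℕ) [NeZero N] (f : ℤ → ℂ)
    (hf : ∀ x y : ℤ, (N : ℤ) ∣ x - y → f x = f y) :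
    ∃ F : ZMod N → ℂ, ∀ x : ℤ, f x = F x := by
  refine ⟨fun x => f (x.val : ℤ), fun x => hf _ _ ?_⟩
  rw [← ZMod.intCast_eq_intCast_iff_dvd_sub]
  simp

lemma sum_shift (N : ℕ) (hN : N ≠ 0) (f : ℤ → ℂ)
    (hf : ∀ x y : ℤ, (N : ℤ) ∣ x - y → f x = f y) (c : ℤ) :
    ∑ a ∈ range N, f (a + c) = ∑ a ∈ range N, f a := by
  have : NeZero N := ⟨hN⟩
  obtain ⟨F, hF⟩ := sum_periodic N f hf
  simp only [hF]
  rw [sum_zmod N F, ← Equiv.sum_comp (Equiv.addRight (c : ZMod N)) F, ← sum_zmod]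
  simp

lemma sum_sub (N : ℕ) (hN : N ≠ 0) (f : ℤ → ℂ)
    (hf : ∀ x y : ℤ, (N : ℤ) ∣ x - y → f x = f y) (c : ℤ) :
    ∑ a ∈ range N, f (c - a) = ∑ a ∈ range N, f a := by
  have : NeZero N := ⟨hN⟩
  obtain ⟨F, hF⟩ := sum_periodic N f hf
  simp only [hF]
  rw [sum_zmod N F, ← Equiv.sum_comp (Equiv.subLeft (c : ZMod N)) F, ← sum_zmod]
  simp

lemma sum_geom (N : ℕ) (hN : N ≠ 0) (c : ℤ) :
    ∑ v ∈ range N, EE N (v * c) = if (N : ℤ) ∣ c then (N : ℂ) else 0 := by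
  have : NeZero N := ⟨hN⟩
  have h := AddChar.sum_mulShift (c : ZMod N) (ZMod.isPrimitive_stdAddChar N)
  rw [ZMod.card, ← sum_zmod] at h
  simp only [EE_std]
  push_cast at h ⊢
  rw [h]
  simp only [ZMod.intCast_zmod_eq_zero_iff_dvd]

lemma jac_congr (p : ℕ) {x y : ℤ} (h : (p : ℤ) ∣ x - y) : jacobiSym x p = jacobiSym y p := by
  apply jacobiSym.mod_left'
  exact Int.emod_eq_emod_iff_emod_sub_eq_zero.2 (Int.emod_eq_zero_of_dvd h)

/-- factorisation of the double sum -/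
lemma omega_factor (p : ℕ) (hp : p.Prime) (k₁ k₂ : ℕ) (α β : ℤ) :
    omegaSum p k₁ k₂ α β =
      (∑ a ∈ range (p ^ (k₁ + 2 * k₂)), EE (p ^ (k₁ + 2 * k₂)) (2 * a * α + a ^ 2 * β)) *
      (∑ t ∈ range (p ^ k₁), ((jacobiSym (t : ℤ) (p ^ k₁) : ℤ) : ℂ) * EE (p ^ k₁) (-(t * β))) := by
  have hp0 : p ≠ 0 := hp.ne_zero
  have hM : p ^ (2 * k₂) ≠ 0 := pow_ne_zero _ hp0
  have hMz : (p : ℤ) ^ (2 * k₂) ≠ 0 := pow_ne_zero _ (by exact_mod_cast hp0)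
  rw [omegaSum, sum_mul]
  refine sum_congr rfl fun a _ => ?_
  have hE : p ^ (k₁ + 2 * k₂) = p ^ (2 * k₂) * p ^ k₁ := by rw [← pow_add, add_comm]
  have hK : p ^ (k₁ + 2 * k₂) ≠ 0 := pow_ne_zero _ hp0
  let f : ℤ → ℂ := fun b => if (p : ℤ) ^ (2 * k₂) ∣ ((a : ℤ) ^ 2 - b) then
      ((jacobiSym (((a : ℤ) ^ 2 - b) / (p : ℤ) ^ (2 * k₂)) (p ^ k₁) : ℤ) : ℂ) *
        EE (p ^ (k₁ + 2 * k₂)) (2 * a * α + b * β)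
    else 0
  have hf : ∀ x y : ℤ, ((p ^ (k₁ + 2 * k₂) : ℕ) : ℤ) ∣ x - y → f x = f y := by
    intro x y hxy
    have h1 : (p : ℤ) ^ (2 * k₂) ∣ x - y := by
      refine dvd_trans ?_ hxy
      rw [hE]; push_cast; exact Dvd.intro _ rfl
    have h2 : (p : ℤ) ^ (2 * k₂) ∣ ((a : ℤ) ^ 2 - x) ↔ (p : ℤ) ^ (2 * k₂) ∣ ((a : ℤ) ^ 2 - y) := by
      have : (a : ℤ) ^ 2 - y = (a ^ 2 - x) + (x - y) := by ring
      rw [this]; exact (Int.dvd_add_left h1).symm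
    simp only [f]
    by_cases h3 : (p : ℤ) ^ (2 * k₂) ∣ ((a : ℤ) ^ 2 - x)
    · rw [if_pos h3, if_pos (h2.1 h3)]
      congr 1
      · congr 1
        apply jac_congr
        obtain ⟨c, hc⟩ := h3
        obtain ⟨d, hd⟩ := h2.1 ⟨c, hc⟩
        rw [hc, hd, Int.mul_ediv_cancel_left _ hMz, Int.mul_ediv_cancel_left _ hMz]
        have : x - y = (p : ℤ) ^ (2 * k₂) * (d - c) := by rw [mul_sub, ← hc, ← hd]; ring
        rw [this, hE] at hxy
        push_cast at hxy ⊢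
        rw [← neg_sub, dvd_neg]
        exact Int.dvd_of_mul_dvd_mul_left hMz hxy
      · apply EE_congr _ hK
        have : 2 * ↑a * α + x * β - (2 * ↑a * α + y * β) = (x - y) * β := by ring
        rw [this]; exact hxy.mul_right _
    · rw [if_neg h3, if_neg (fun h => h3 (h2.2 h))]
  have h0 := sum_sub _ hK f hf ((a : ℤ) ^ 2)
  have h1 : ∀ b : ℕ, (if (p : ℤ) ^ (2 * k₂) ∣ ((a : ℤ) ^ 2 - (b : ℤ)) then
      ((jacobiSym (((a : ℤ) ^ 2 - (b : ℤ)) / (p : ℤ) ^ (2 * k₂)) (p ^ k₁) : ℤ) : ℂ) *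
        e2 (((2 * a * α + b * β : ℤ) : ℝ) / (p : ℝ) ^ (k₁ + 2 * k₂))
    else 0) = f b := by
    intro b
    simp only [f, EE]
    push_cast
    rfl
  rw [sum_congr rfl fun b _ => h1 b, ← h0]
  simp only [f, sub_sub_cancel]
  have h2 := sum_dvd (p ^ (2 * k₂)) (p ^ k₁) hM (fun c : ℤ =>
      ((jacobiSym (c / (p : ℤ) ^ (2 * k₂)) (p ^ k₁) : ℤ) : ℂ) *
        EE (p ^ (k₁ + 2 * k₂)) (2 * a * α + (a ^ 2 - c) * β))
  rw [← hE] at h2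
  push_cast at h2
  rw [h2, mul_sum]
  refine sum_congr rfl fun t _ => ?_
  rw [Int.mul_ediv_cancel_left _ hMz]
  have h3 : 2 * (a : ℤ) * α + (a ^ 2 - (p : ℤ) ^ (2 * k₂) * t) * β =
      (2 * a * α + a ^ 2 * β) + ((p ^ (2 * k₂) : ℕ) : ℤ) * (-(t * β)) := by push_cast; ring
  have h4 : EE (p ^ (k₁ + 2 * k₂)) (((p ^ (2 * k₂) : ℕ) : ℤ) * (-(t * β))) =
      EE (p ^ k₁) (-(t * β)) := by
    rw [pow_add, EE_cancel _ _ hM]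
  rw [h3, EE_add, h4]
  ring

lemma jac_quad (p : ℕ) [Fact p.Prime] (t : ℤ) :
    jacobiSym t p = quadraticChar (ZMod p) (t : ZMod p) := by
  rw [← jacobiSym.legendreSym.to_jacobiSym, legendreSym]

/-- Gauss sum with a shift -/
lemma chi_sum (p : ℕ) (hp : p.Prime) (h2 : p ≠ 2) (β : ℤ) :
    ∑ t ∈ range p, ((jacobiSym (t : ℤ) p : ℤ) : ℂ) * EE p (t * β) =
      ((jacobiSym β p : ℤ) : ℂ) *
        ∑ t ∈ range p, ((jacobiSym (t : ℤ) p : ℤ) : ℂ) * EE p t := by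
  have : Fact p.Prime := ⟨hp⟩
  simp only [EE_std, jac_quad]
  have e1 := sum_zmod p (fun x => ((quadraticChar (ZMod p) x : ℤ) : ℂ) *
    ZMod.stdAddChar (x * (β : ZMod p)))
  have e2 := sum_zmod p (fun x => ((quadraticChar (ZMod p) x : ℤ) : ℂ) * ZMod.stdAddChar x)
  push_cast at e1 e2 ⊢
  rw [e1, e2]
  by_cases hb : (β : ZMod p) = 0
  · simp only [hb, mul_zero, AddChar.map_zero_eq_one, mul_one]
    have : (∑ x : ZMod p, quadraticChar (ZMod p) x) = 0 :=
      quadraticChar_sum_zero (by rwa [ZMod.ringChar_zmod_n])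
    rw [← Int.cast_sum, this]
    simp
  · have hsq : ((quadraticChar (ZMod p) (β : ZMod p) : ℤ) : ℂ) *
        ((quadraticChar (ZMod p) (β : ZMod p) : ℤ) : ℂ) = 1 := by
      rw [← sq]
      exact_mod_cast quadraticChar_sq_one hb
    have h3 : ∑ x : ZMod p, ((quadraticChar (ZMod p) x : ℤ) : ℂ) * ZMod.stdAddChar x =
        ∑ x : ZMod p, ((quadraticChar (ZMod p) (x * β) : ℤ) : ℂ) *
          ZMod.stdAddChar (x * (β : ZMod p)) := by
      exact (Equiv.sum_comp (Equiv.mulRight₀ (β : ZMod p) hb)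
        (fun x => ((quadraticChar (ZMod p) x : ℤ) : ℂ) * ZMod.stdAddChar x)).symm
    rw [h3, mul_sum]
    refine sum_congr rfl fun x _ => ?_
    rw [map_mul (quadraticChar (ZMod p))]
    push_cast
    linear_combination (-((quadraticChar (ZMod p) x : ℤ) : ℂ) *
          ZMod.stdAddChar (x * (β : ZMod p))) * hsq

lemma sq_sum (p : ℕ) (hp : p.Prime) (h2 : p ≠ 2) (β : ℤ) (hβ : ¬ (p : ℤ) ∣ β) :
    ∑ a ∈ range p, EE p (a ^ 2 * β) =
      ∑ t ∈ range p, ((jacobiSym (t : ℤ) p : ℤ) : ℂ) * EE p (t * β) := by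
  have : Fact p.Prime := ⟨hp⟩
  have hg := sum_geom p hp.ne_zero β
  rw [if_neg hβ] at hg
  have h0 : ∑ t ∈ range p, ((jacobiSym (t : ℤ) p : ℤ) : ℂ) * EE p (t * β) =
      ∑ t ∈ range p, (((jacobiSym (t : ℤ) p + 1 : ℤ)) : ℂ) * EE p (t * β) := by
    push_cast
    simp only [add_mul, sum_add_distrib, one_mul, hg, add_zero]
  rw [h0]
  simp only [EE_std, jac_quad]
  have e1 := sum_zmod p (fun x => ((quadraticChar (ZMod p) x + 1 : ℤ) : ℂ) *
    ZMod.stdAddChar (x * (β : ZMod p)))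
  have e2 := sum_zmod p (fun x => (ZMod.stdAddChar (x ^ 2 * (β : ZMod p)) : ℂ))
  push_cast at e1 e2 ⊢
  rw [e1, e2, ← sum_fiberwise (s := univ) (g := fun x : ZMod p => x ^ 2)]
  refine sum_congr rfl fun y _ => ?_
  have h3 := quadraticChar_card_sqrts (F := ZMod p) (by rwa [ZMod.ringChar_zmod_n]) y
  have h4 : (((quadraticChar (ZMod p) y + 1 : ℤ)) : ℂ) =
      (#{x : ZMod p | x ^ 2 = y} : ℂ) := by
    rw [← h3]
    simp [Set.toFinset_ofPred]
  push_cast at h4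
  rw [h4, ← nsmul_eq_mul, ← sum_const]
  refine sum_congr rfl fun x hx => ?_
  simp at hx
  rw [hx]

lemma quad_rec (p : ℕ) (hp : p.Prime) (h2 : p ≠ 2) (β : ℤ) (hβ : ¬ (p : ℤ) ∣ β) (m : ℕ) :
    ∑ a ∈ range (p ^ (m + 2)), EE (p ^ (m + 2)) (a ^ 2 * β) =
      p * ∑ a ∈ range (p ^ m), EE (p ^ m) (a ^ 2 * β) := by
  have hp0 := hp.ne_zero
  have hpz : Prime (p : ℤ) := Nat.prime_iff_prime_int.1 hp
  have h2z : ¬ (p : ℤ) ∣ 2 := by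
    intro h
    have : p ∣ 2 := by exact_mod_cast h
    exact h2 ((Nat.prime_dvd_prime_iff_eq hp Nat.prime_two).1 this)
  have e1 : range (p ^ (m + 2)) = range (p ^ (m + 1) * p) := by rw [← pow_succ]
  rw [e1, sum_split, sum_comm]
  have h3 : ∀ u : ℕ, ∑ v ∈ range p,
      EE (p ^ (m + 2)) (((u + p ^ (m + 1) * v : ℕ) : ℤ) ^ 2 * β) =
      if (p : ℤ) ∣ (u : ℤ) then (p : ℂ) * EE (p ^ (m + 2)) ((u : ℤ) ^ 2 * β) else 0 := by
    intro u
    have h4 : ∀ v : ℕ, EE (p ^ (m + 2)) (((u + p ^ (m + 1) * v : ℕ) : ℤ) ^ 2 * β) =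
        EE (p ^ (m + 2)) ((u : ℤ) ^ 2 * β) * EE p (v * (2 * u * β)) := by
      intro v
      have h5 : EE p (v * (2 * u * β)) =
          EE (p ^ (m + 2)) (((p ^ (m + 1) : ℕ) : ℤ) * (v * (2 * u * β))) := by
        rw [← EE_cancel p (p ^ (m + 1)) (pow_ne_zero _ hp0)]
        congr 1; ring
      rw [h5, ← EE_add]
      apply EE_congr _ (pow_ne_zero _ hp0)
      refine ⟨(p : ℤ) ^ m * v ^ 2 * β, ?_⟩
      push_cast; ring
    simp only [h4, ← mul_sum]
    rw [sum_geom p hp0]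
    have h6 : (p : ℤ) ∣ 2 * u * β ↔ (p : ℤ) ∣ u := by
      rw [hpz.dvd_mul, hpz.dvd_mul]; tauto
    simp only [h6]
    split_ifs <;> ring
  rw [sum_congr rfl fun u _ => h3 u]
  have e2 : range (p ^ (m + 1)) = range (p * p ^ m) := by rw [pow_succ']
  rw [e2, sum_dvd p (p ^ m) hp0 (fun u : ℤ => (p : ℂ) * EE (p ^ (m + 2)) (u ^ 2 * β)), mul_sum]
  refine sum_congr rfl fun t _ => ?_
  congr 1
  rw [← EE_cancel (p ^ m) (p ^ 2) (pow_ne_zero _ hp0)]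
  rw [← pow_add]
  congr 1
  push_cast; ring

lemma quad_jac (p : ℕ) (hp : p.Prime) (h2 : p ≠ 2) (β : ℤ) (m : ℕ)
    (hβ : m = 0 ∨ ¬ (p : ℤ) ∣ β) :
    ∑ a ∈ range (p ^ m), EE (p ^ m) (a ^ 2 * β) =
      ((jacobiSym β (p ^ m) : ℤ) : ℂ) * ∑ a ∈ range (p ^ m), EE (p ^ m) (a ^ 2 * 1) := by
  have h1p : ¬ (p : ℤ) ∣ 1 := by
    intro h
    have : p ∣ 1 := by exact_mod_cast h
    exact hp.one_lt.ne' (Nat.dvd_one.1 this)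
  induction m using Nat.twoStepInduction with
  | zero => simp [EE_zero]
  | one =>
    have hβ' : ¬ (p : ℤ) ∣ β := by simpa using hβ
    simp only [pow_one]
    rw [sq_sum p hp h2 β hβ', sq_sum p hp h2 1 h1p, chi_sum p hp h2 β]
    simp only [mul_one]
  | more m ih _ =>
    have hβ' : ¬ (p : ℤ) ∣ β := by simpa using hβ
    rw [quad_rec p hp h2 β hβ', quad_rec p hp h2 1 h1p, ih (Or.inr hβ'),
      jacobiSym.pow_right, jacobiSym.pow_right, pow_add, jacobiSym.sq_one]
    · push_cast; ring
    · rw [Int.gcd_comm]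
      have : IsCoprime (p : ℤ) β := (Prime.coprime_iff_not_dvd
        (Nat.prime_iff_prime_int.1 hp)).2 hβ'
      exact Int.isCoprime_iff_gcd_eq_one.1 this

lemma quad_eval (p : ℕ) (hp : p.Prime) (h2 : p ≠ 2) (β : ℤ) (m : ℕ)
    (hβ : m = 0 ∨ ¬ (p : ℤ) ∣ β) :
    ∑ a ∈ range (p ^ m), EE (p ^ m) (a ^ 2 * β) =
      ((jacobiSym β (p ^ m) : ℤ) : ℂ) * ((Real.sqrt ((p : ℝ) ^ m) : ℂ) * eta (p ^ m)) := by
  rw [quad_jac p hp h2 β m hβ]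
  have := gauss_range (p ^ m) (pow_pos hp.pos _)
  push_cast at this
  rw [← this]
  simp [EE]

lemma chi_eval (p : ℕ) (hp : p.Prime) (h2 : p ≠ 2) (β : ℤ) :
    ∑ t ∈ range p, ((jacobiSym (t : ℤ) p : ℤ) : ℂ) * EE p (t * β) =
      ((jacobiSym β p : ℤ) : ℂ) * ((Real.sqrt p : ℂ) * eta p) := by
  have h1p : ¬ (p : ℤ) ∣ 1 := by
    intro h
    have : p ∣ 1 := by exact_mod_cast h
    exact hp.one_lt.ne' (Nat.dvd_one.1 this)
  have h3 := sq_sum p hp h2 1 h1p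
  have h4 := quad_eval p hp h2 1 1 (Or.inr h1p)
  simp only [pow_one, h3] at h4
  simp only [mul_one] at h4
  rw [chi_sum p hp h2, h4]
  simp

lemma lin_eval (p : ℕ) (hp : p.Prime) (h2 : p ≠ 2) (α β c : ℤ) (m : ℕ)
    (hβ : m = 0 ∨ ¬ (p : ℤ) ∣ β) (hc : ((p ^ m : ℕ) : ℤ) ∣ β * c - α) :
    ∑ a ∈ range (p ^ m), EE (p ^ m) (2 * a * α + a ^ 2 * β) =
      EE (p ^ m) (-(β * c ^ 2)) *
      (((jacobiSym β (p ^ m) : ℤ) : ℂ) * ((Real.sqrt ((p : ℝ) ^ m) : ℂ) * eta (p ^ m))) := by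
  have hN : p ^ m ≠ 0 := pow_ne_zero _ hp.ne_zero
  rw [← quad_eval p hp h2 β m hβ, ← sum_shift (p ^ m) hN (fun a => EE (p ^ m) (a ^ 2 * β)) ?_ c,
    mul_sum]
  · refine sum_congr rfl fun a _ => ?_
    rw [← EE_add]
    apply EE_congr _ hN
    have : 2 * (a : ℤ) * α + a ^ 2 * β - (-(β * c ^ 2) + (a + c) ^ 2 * β) =
      (β * c - α) * (-2 * a) := by ring
    rw [this]
    exact hc.mul_right _
  · intro x y hxy
    apply EE_congr _ hN
    have : x ^ 2 * β - y ^ 2 * β = (x - y) * ((x + y) * β) := by ring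
    rw [this]; exact hxy.mul_right _

lemma scaled_eval (p : ℕ) (hp : p.Prime) (α β : ℤ) (m w : ℕ) :
    ∑ a ∈ range (p ^ (m + w)), EE (p ^ (m + w)) (2 * a * ((p : ℤ) ^ w * α) +
      a ^ 2 * ((p : ℤ) ^ w * β)) =
      (p : ℂ) ^ w * ∑ a ∈ range (p ^ m), EE (p ^ m) (2 * a * α + a ^ 2 * β) := by
  have e1 : range (p ^ (m + w)) = range (p ^ m * p ^ w) := by rw [← pow_add]
  rw [e1, sum_split]
  have h : ∀ v ∈ range (p ^ w), ∑ u ∈ range (p ^ m), EE (p ^ (m + w))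
      (2 * ((u + p ^ m * v : ℕ) : ℤ) * ((p : ℤ) ^ w * α) +
        ((u + p ^ m * v : ℕ) : ℤ) ^ 2 * ((p : ℤ) ^ w * β)) =
      ∑ a ∈ range (p ^ m), EE (p ^ m) (2 * a * α + a ^ 2 * β) := by
    intro v _
    refine sum_congr rfl fun u _ => ?_
    have h1 := EE_cancel (p ^ m) (p ^ w) (pow_ne_zero _ hp.ne_zero)
      (2 * ((u + p ^ m * v : ℕ) : ℤ) * α + ((u + p ^ m * v : ℕ) : ℤ) ^ 2 * β)
    rw [← pow_add] at h1
    rw [EE_congr (p ^ m) (pow_ne_zero _ hp.ne_zero) (y := 2 * u * α + u ^ 2 * β)] at h1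
    · rw [← h1]; congr 1; push_cast; ring
    · refine ⟨2 * v * α + (2 * u * v + (p : ℤ) ^ m * v ^ 2) * β, ?_⟩
      push_cast; ring
  rw [sum_congr rfl h]
  simp

lemma vanish (p : ℕ) (hp : p.Prime) (h2 : p ≠ 2) (α β : ℤ) (K w : ℕ) (hw : w ≤ K)
    (hβ : (p : ℤ) ^ w ∣ β) (hα : ¬ (p : ℤ) ^ w ∣ α) :
    ∑ a ∈ range (p ^ K), EE (p ^ K) (2 * a * α + a ^ 2 * β) = 0 := by
  obtain ⟨m, rfl⟩ := Nat.exists_eq_add_of_le' hw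
  have hN : p ^ (m + w) ≠ 0 := pow_ne_zero _ hp.ne_zero
  obtain ⟨b, rfl⟩ := hβ
  have hs := sum_shift (p ^ (m + w)) hN
    (fun a => EE (p ^ (m + w)) (2 * a * α + a ^ 2 * ((p : ℤ) ^ w * b))) (by
      intro x y hxy
      apply EE_congr _ hN
      have : 2 * x * α + x ^ 2 * ((p : ℤ) ^ w * b) - (2 * y * α + y ^ 2 * ((p : ℤ) ^ w * b)) =
        (x - y) * (2 * α + (x + y) * ((p : ℤ) ^ w * b)) := by ring
      rw [this]; exact hxy.mul_right _) ((p : ℤ) ^ m)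
  have h1 : ∀ a : ℕ, EE (p ^ (m + w)) (2 * (a + (p : ℤ) ^ m) * α +
      (a + (p : ℤ) ^ m) ^ 2 * ((p : ℤ) ^ w * b)) =
      EE (p ^ w) (2 * α) * EE (p ^ (m + w)) (2 * a * α + a ^ 2 * ((p : ℤ) ^ w * b)) := by
    intro a
    rw [← EE_cancel (p ^ w) (p ^ m) (pow_ne_zero _ hp.ne_zero), ← pow_add, add_comm w m,
      ← EE_add]
    apply EE_congr _ hN
    refine ⟨2 * a * b + (p : ℤ) ^ m * b, ?_⟩
    push_cast; ring
  simp only [h1, ← mul_sum] at hs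
  by_contra h0
  have h3 : EE (p ^ w) (2 * α) = 1 := by
    have := mul_right_cancel₀ h0 (hs.trans (one_mul _).symm)
    exact this
  have h4 := EE_eq_one _ (pow_ne_zero _ hp.ne_zero) h3
  push_cast at h4
  have hc : IsCoprime ((p : ℤ) ^ w) 2 := by
    apply IsCoprime.pow_left
    rw [Int.isCoprime_iff_gcd_eq_one]
    exact_mod_cast (Nat.coprime_primes hp Nat.prime_two).2 h2
  exact hα (hc.dvd_of_dvd_mul_left h4)

lemma S_split (p : ℕ) (hp : p.Prime) (k : ℕ) (β : ℤ) :
    ∑ t ∈ range (p ^ (k + 1)), ((jacobiSym (t : ℤ) (p ^ (k + 1)) : ℤ) : ℂ) *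
        EE (p ^ (k + 1)) (-(t * β)) =
      (∑ u ∈ range p, ((jacobiSym (u : ℤ) p : ℤ) : ℂ) ^ (k + 1) * EE (p ^ (k + 1)) (-(u * β))) *
        (if (p : ℤ) ^ k ∣ β then (p : ℂ) ^ k else 0) := by
  have e1 : range (p ^ (k + 1)) = range (p * p ^ k) := by rw [pow_succ']
  have hg := sum_geom (p ^ k) (pow_ne_zero _ hp.ne_zero) (-β)
  push_cast at hg
  simp only [dvd_neg] at hg
  rw [e1, sum_split, sum_comm, ← hg, sum_mul]
  refine sum_congr rfl fun u _ => ?_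
  rw [mul_sum]
  refine sum_congr rfl fun v _ => ?_
  rw [jacobiSym.pow_right, jac_congr p (y := (u : ℤ)) ⟨v, by push_cast; ring⟩]
  have h := EE_cancel (p ^ k) p hp.ne_zero ((v : ℤ) * -β)
  rw [← pow_succ] at h
  rw [← h, mul_assoc, ← EE_add]
  push_cast
  congr 2
  ring

lemma S_eval (p : ℕ) (hp : p.Prime) (h2 : p ≠ 2) (k₁ : ℕ) (β : ℤ) (hβ : β ≠ 0) :
    (∑ t ∈ range (p ^ k₁), ((jacobiSym (t : ℤ) (p ^ k₁) : ℤ) : ℂ) * EE (p ^ k₁) (-(t * β))) =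
      if k₁ ≤ padicValInt p β ∧ Even k₁ then (Nat.totient (p ^ k₁) : ℂ)
      else if (padicValInt p β : ℤ) = (k₁ : ℤ) - 1 ∧ Even k₁ then
        -((p : ℂ) ^ (k₁ - 1))
      else if (padicValInt p β : ℤ) = (k₁ : ℤ) - 1 ∧ Odd k₁ then
        ((jacobiSym (-(β / (p : ℤ) ^ (k₁ - 1))) p : ℤ) : ℂ) * eta p *
          (((p : ℝ) ^ ((k₁ : ℝ) - 1/2) : ℝ) : ℂ)
      else 0 := by
  have : Fact p.Prime := ⟨hp⟩
  have hp0 := hp.ne_zero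
  have hpz : (p : ℤ) ≠ 0 := by exact_mod_cast hp0
  have hv : ∀ n : ℕ, (p : ℤ) ^ n ∣ β ↔ n ≤ padicValInt p β := by
    intro n
    rw [padicValInt_dvd_iff]; simp [hβ]
  cases k₁ with
  | zero => simp [EE_zero]
  | succ k =>
    rw [S_split p hp]
    by_cases hk : k ≤ padicValInt p β
    · rw [if_pos ((hv k).2 hk)]
      obtain ⟨b, hb⟩ := (hv k).2 hk
      have hpb : (p : ℤ) ∣ b ↔ k + 1 ≤ padicValInt p β := by
        rw [← hv, hb, pow_succ]
        exact (mul_dvd_mul_iff_left (pow_ne_zero _ hpz)).symm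
      have hE : ∀ u : ℕ, EE (p ^ (k + 1)) (-(u * β)) = EE p (u * -b) := by
        intro u
        have h := EE_cancel p (p ^ k) (pow_ne_zero _ hp0) (u * -b)
        rw [← pow_succ'] at h
        rw [← h, hb]
        congr 1; push_cast; ring
      simp only [hE]
      rcases Nat.even_or_odd (k + 1) with he | ho
      · have ho : ¬ Odd (k + 1) := Nat.not_odd_iff_even.2 he
        have hJ : ∀ u ∈ range p, ((jacobiSym (u : ℤ) p : ℤ) : ℂ) ^ (k + 1) * EE p (u * -b) =
            EE p (u * -b) - if u = 0 then 1 else 0 := by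
          intro u hu
          by_cases hu0 : u = 0
          · subst hu0
            simp [jacobiSym.zero_left hp.one_lt, EE_zero]
          · have h1 : (u : ℤ).gcd p = 1 := by
              have : Nat.Coprime u p := by
                rw [Nat.coprime_comm, hp.coprime_iff_not_dvd]
                intro h
                exact absurd (Nat.le_of_dvd (Nat.pos_of_ne_zero hu0) h) (by simpa using hu)
              exact_mod_cast this
            obtain ⟨j, hj⟩ := he.two_dvd
            have h3 : ((jacobiSym (u : ℤ) p : ℤ) : ℂ) ^ 2 = 1 := by
              exact_mod_cast jacobiSym.sq_one h1
            rw [hj, pow_mul, h3, if_neg hu0]; simp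
        rw [sum_congr rfl hJ, sum_sub_distrib, sum_geom p hp0, sum_ite_eq',
          if_pos (mem_range.2 hp.pos : 0 ∈ range p)]
        simp only [dvd_neg]
        by_cases h4 : k + 1 ≤ padicValInt p β
        · rw [if_pos (hpb.2 h4), if_pos ⟨h4, he⟩, Nat.totient_prime_pow_succ hp]
          push_cast [Nat.cast_sub hp.one_le]
          ring
        · have h5 : padicValInt p β = k := by omega
          rw [if_neg (fun h => h4 (hpb.1 h)), if_neg (fun h => h4 h.1), if_pos ⟨by
            rw [h5]; push_cast; ring, he⟩]
          simp
      · have he : ¬ Even (k + 1) := Nat.not_even_iff_odd.2 ho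
        have hJ : ∀ u ∈ range p, ((jacobiSym (u : ℤ) p : ℤ) : ℂ) ^ (k + 1) * EE p (u * -b) =
            ((jacobiSym (u : ℤ) p : ℤ) : ℂ) * EE p (u * -b) := by
          intro u _
          congr 1
          rcases jacobiSym.trichotomy (u : ℤ) p with h | h | h
          · simp [h]
          · simp [h]
          · simp [h, ho.neg_one_pow]
        rw [sum_congr rfl hJ, chi_eval p hp h2, if_neg (fun h => he h.2), if_neg (fun h => he h.2)]
        by_cases h4 : k + 1 ≤ padicValInt p β
        · have h5 : jacobiSym (-b) p = 0 := by
            rw [jac_congr p (y := 0) (by simpa using hpb.2 h4), jacobiSym.zero_left hp.one_lt]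
          rw [h5, if_neg (fun h => by have := h.1; push_cast at this; omega)]
          simp
        · have h5 : padicValInt p β = k := by omega
          rw [if_pos ⟨by rw [h5]; push_cast; ring, ho⟩]
          have h6 : β / (p : ℤ) ^ (k + 1 - 1) = b := by
            rw [hb, Nat.add_sub_cancel, Int.mul_ediv_cancel_left _ (pow_ne_zero _ hpz)]
          have h7 : (p : ℝ) ^ (((k + 1 : ℕ) : ℝ) - 1 / 2) = (p : ℝ) ^ k * Real.sqrt p := by
            have : (((k + 1 : ℕ) : ℝ) - 1 / 2) = k + 1 / 2 := by push_cast; ring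
            rw [this, Real.rpow_add (by exact_mod_cast hp.pos), Real.rpow_natCast,
              Real.sqrt_eq_rpow]
          rw [h6, h7]
          push_cast
          ring
    · rw [if_neg (fun h => hk ((hv k).1 h)), if_neg (fun h => hk (by have := h.1; omega)),
        if_neg (fun h => hk (by have := h.1; push_cast at this; omega)),
        if_neg (fun h => hk (by have := h.1; push_cast at this; omega)), mul_zero]

end Algebraic

/-- Evaluation of `ω_{p^{k₁},p^{k₂}}(α, β)` for an odd prime `p` and `β ≠ 0`:
with `K = k₁ + 2k₂`, `w = min(v_p(β), K)`, one has `ω = τ·c` where `τ = 0` if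
`v_p(α) < w`, and otherwise
`τ = p^{(K+w)/2}·η(p^{K−w})·((β/p^w) | p^{K−w})·e(−β(α₀q)²/p^K)` for any inverse
`q` of `β₀ = β/gcd(α,β)` mod `p^{K−w}` (with `α₀ = α/gcd(α,β)`), and `c` is as
in the twisted-sum evaluation. -/
theorem omegaSum_eval (p : ℕ) (hp : p.Prime) (hodd : Odd p) (k₁ k₂ : ℕ)
    (α β : ℤ) (hβ : β ≠ 0) :
    let K : ℕ := k₁ + 2 * k₂
    let w : ℕ := min (padicValInt p β) K
    let c : ℂ :=
      if k₁ ≤ padicValInt p β ∧ Even k₁ then (Nat.totient (p ^ k₁) : ℂ)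
      else if (padicValInt p β : ℤ) = (k₁ : ℤ) - 1 ∧ Even k₁ then
        -((p : ℂ) ^ (k₁ - 1))
      else if (padicValInt p β : ℤ) = (k₁ : ℤ) - 1 ∧ Odd k₁ then
        ((jacobiSym (-(β / (p : ℤ) ^ (k₁ - 1))) p : ℤ) : ℂ) * eta p *
          (((p : ℝ) ^ ((k₁ : ℝ) - 1/2) : ℝ) : ℂ)
      else 0
    ((¬ (p : ℤ) ^ w ∣ α → omegaSum p k₁ k₂ α β = 0) ∧
      ((p : ℤ) ^ w ∣ α →
        ∀ q : ℤ, (β / (Int.gcd α β : ℤ)) * q ≡ 1 [ZMOD (p : ℤ) ^ (K - w)] →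
          omegaSum p k₁ k₂ α β =
            (((p : ℝ) ^ (((K : ℝ) + (w : ℝ)) / 2) : ℝ) : ℂ) * eta (p ^ (K - w)) *
              ((jacobiSym (β / (p : ℤ) ^ w) (p ^ (K - w)) : ℤ) : ℂ) *
              e2 (((-(β * ((α / (Int.gcd α β : ℤ)) * q) ^ 2) : ℤ) : ℝ) / (p : ℝ) ^ K) *
              c)) := by
  intro K w c
  have : Fact p.Prime := ⟨hp⟩
  have h2 : p ≠ 2 := by rintro rfl; exact absurd hodd (by decide)
  have hp0 := hp.ne_zero
  have hpz : (p : ℤ) ≠ 0 := by exact_mod_cast hp0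
  have hv : ∀ n : ℕ, (p : ℤ) ^ n ∣ β ↔ n ≤ padicValInt p β := by
    intro n
    rw [padicValInt_dvd_iff]; simp [hβ]
  have hwβ : (p : ℤ) ^ w ∣ β := (hv w).2 (min_le_left _ _)
  have hwK : w ≤ K := min_le_right _ _
  have hS := S_eval p hp h2 k₁ β hβ
  have hfac := omega_factor p hp k₁ k₂ α β
  rw [hS] at hfac
  refine ⟨fun hα => ?_, fun hα q hq => ?_⟩
  · rw [hfac, vanish p hp h2 α β K w hwK hwβ hα, zero_mul]
  · rw [hfac]
    congr 1
    obtain ⟨m, hm⟩ := Nat.exists_eq_add_of_le' hwK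
    have hKw : K - w = m := by omega
    rw [hKw] at hq ⊢
    have hδα : ((Int.gcd α β : ℤ)) ∣ α := Int.gcd_dvd_left _ _
    have hδβ : ((Int.gcd α β : ℤ)) ∣ β := Int.gcd_dvd_right _ _
    have hδ : (p : ℤ) ^ w ∣ (Int.gcd α β : ℤ) := Int.dvd_coe_gcd hα hwβ
    have hα0 := Int.mul_ediv_cancel' hδα
    have hβ0 := Int.mul_ediv_cancel' hδβ
    set δ : ℤ := (Int.gcd α β : ℤ)
    set α₀ := α / δ
    set β₀ := β / δ
    obtain ⟨a', ha'⟩ := hα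
    obtain ⟨b', hb'⟩ := hwβ
    have hpw : (p : ℤ) ^ w ≠ 0 := pow_ne_zero _ hpz
    have hc : ((p ^ m : ℕ) : ℤ) ∣ b' * (α₀ * q) - a' := by
      obtain ⟨d, hd⟩ := hδ
      obtain ⟨s, hs⟩ := hq.symm.dvd
      have h3 : (p : ℤ) ^ w * (b' * (α₀ * q) - a') = (p : ℤ) ^ w * ((p : ℤ) ^ m * (d * α₀ * s)) := by
        have : (p : ℤ) ^ w * (b' * (α₀ * q) - a') = β * (α₀ * q) - α := by rw [hb', ha']; ring
        rw [this, ← hβ0, ← hα0]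
        have : δ * β₀ * (α₀ * q) - δ * α₀ = δ * α₀ * (β₀ * q - 1) := by ring
        rw [this, hs, hd]; ring
      have h4 := mul_left_cancel₀ hpw h3
      rw [h4]; push_cast; exact Dvd.intro _ rfl
    have hb : m = 0 ∨ ¬ (p : ℤ) ∣ b' := by
      by_cases h : m = 0
      · exact Or.inl h
      · right
        intro hd
        have h3 : (p : ℤ) ^ (w + 1) ∣ β := by
          rw [hb', pow_succ]; exact mul_dvd_mul_left _ hd
        have h4 := (hv _).1 h3
        have h5 : w = min (padicValInt p β) K := rfl
        omega
    have e1 := scaled_eval p hp a' b' m w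
    rw [← ha', ← hb', ← hm, lin_eval p hp h2 a' b' (α₀ * q) m hb hc] at e1
    have e0 : β / (p : ℤ) ^ w = b' := by rw [hb', Int.mul_ediv_cancel_left _ hpw]
    rw [e0]
    have e4 : e2 (((-(β * (α₀ * q) ^ 2) : ℤ) : ℝ) / (p : ℝ) ^ K) =
        EE (p ^ m) (-(b' * (α₀ * q) ^ 2)) := by
      rw [← EE_cancel (p ^ m) (p ^ w) (pow_ne_zero _ hp0), ← pow_add, ← hm, EE]
      have : ((p ^ w : ℕ) : ℤ) * (-(b' * (α₀ * q) ^ 2)) = -(β * (α₀ * q) ^ 2) := by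
        rw [hb']; push_cast; ring
      rw [this, Nat.cast_pow]
    have e5 : (p : ℝ) ^ (((K : ℝ) + (w : ℝ)) / 2) = (p : ℝ) ^ w * Real.sqrt ((p : ℝ) ^ m) := by
      have hppos : (0 : ℝ) < p := by exact_mod_cast hp.pos
      have : ((K : ℝ) + (w : ℝ)) / 2 = w + m * (1 / 2) := by rw [hm]; push_cast; ring
      rw [this, Real.rpow_add hppos, Real.rpow_natCast, Real.rpow_mul hppos.le, Real.rpow_natCast,
        Real.sqrt_eq_rpow]
    rw [e4, e5]
    refine e1.trans ?_
    push_cast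
    ring
end

section
/- There is an absolute constant C such that for every odd prime p, all k₁, k₂ ∈ ℕ with k₁ ≥ 1, and all α, β ∈ ℤ the following holds: if p^{k₁−1} | β and gcd(p^{k₁+2k₂}, β) | α, then |ω_{p^{k₁},p^{k₂}}(α, β)| ≤ C · p^{k₁+k₂} · √( gcd(p^{k₁+2k₂}, β) · gcd(p^{k₁}, β) ); otherwise ω_{p^{k₁},p^{k₂}}(α, β) = 0. Here gcd(q, 0) = q. -/
open Finset

lemma sum_range_zmod (q : ℕ) [NeZero q] (F : ℤ → ℂ) :
    ∑ b ∈ range q, F (b : ℤ) = ∑ x : ZMod q, F (x.val : ℤ) := by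
  symm
  refine Finset.sum_bij' (fun x _ => x.val) (fun b _ => (b : ZMod q)) ?_ ?_ ?_ ?_ ?_
  · intro x _; exact mem_range.2 (ZMod.val_lt x)
  · intro b _; exact mem_univ _
  · intro x _; simp
  · intro b hb; exact ZMod.val_cast_of_lt (mem_range.1 hb)
  · intro x _; rfl

lemma sum_range_zmod' (q : ℕ) [NeZero q] (F : ZMod q → ℂ) :
    ∑ b ∈ range q, F ((b : ℤ) : ZMod q) = ∑ x : ZMod q, F x := by
  rw [sum_range_zmod q (fun b => F (b : ZMod q))]
  simp

lemma sum_range_reflect_per (q : ℕ) [NeZero q] (F : ℤ → ℂ)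
    (hF : ∀ m n : ℤ, (q : ℤ) ∣ m - n → F m = F n) (s : ℤ) :
    ∑ b ∈ range q, F (b : ℤ) = ∑ b ∈ range q, F (s - b) := by
  rw [sum_range_zmod q F, sum_range_zmod q (fun b => F (s - b))]
  rw [← (Equiv.subLeft (s : ZMod q)).sum_comp]
  refine Finset.sum_congr rfl fun x _ => hF _ _ ?_
  rw [← ZMod.intCast_zmod_eq_zero_iff_dvd]
  simp

lemma sum_range_shift_per (q : ℕ) [NeZero q] (F : ℤ → ℂ)
    (hF : ∀ m n : ℤ, (q : ℤ) ∣ m - n → F m = F n) (s : ℤ) :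
    ∑ b ∈ range q, F (b : ℤ) = ∑ b ∈ range q, F (s + b) := by
  rw [sum_range_zmod q F, sum_range_zmod q (fun b => F (s + b))]
  rw [← Equiv.sum_comp (Equiv.addLeft (s : ZMod q))]
  refine Finset.sum_congr rfl fun x _ => hF _ _ ?_
  rw [← ZMod.intCast_zmod_eq_zero_iff_dvd]
  simp

lemma sum_range_dvd (P m : ℕ) (hP : 0 < P) (f : ℤ → ℂ) :
    (∑ b ∈ range (m * P), if (P : ℤ) ∣ (b : ℤ) then f ((b : ℤ) / P) else 0)
      = ∑ c ∈ range m, f c := by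
  rw [← Finset.sum_filter]
  symm
  refine Finset.sum_bij' (fun c _ => c * P) (fun b _ => b / P) ?_ ?_ ?_ ?_ ?_
  · intro c hc
    simp only [mem_filter, mem_range] at hc ⊢
    exact ⟨Nat.mul_lt_mul_of_pos_right hc hP, by simp⟩
  · intro b hb
    simp only [mem_filter, mem_range] at hb ⊢
    exact (Nat.div_lt_iff_lt_mul hP).2 hb.1
  · intro c _; exact Nat.mul_div_cancel _ hP
  · intro b hb
    simp only [mem_filter, mem_range] at hb
    exact Nat.div_mul_cancel (Int.natCast_dvd_natCast.1 hb.2)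
  · intro c _
    have : (P : ℤ) ≠ 0 := by positivity
    push_cast
    rw [Int.mul_ediv_cancel _ this]

lemma sum_range_mul_per (p m : ℕ) (f : ℕ → ℂ) (hf : ∀ n, f (n + p) = f n) :
    ∑ n ∈ range (m * p), f n = m * ∑ n ∈ range p, f n := by
  have h : ∀ k n, f (k * p + n) = f n := by
    intro k
    induction k with
    | zero => intro n; simp
    | succ k ih => intro n; rw [← ih n, ← hf (k * p + n)]; congr 1; ring
  induction m with
  | zero => simp
  | succ m ih =>
    rw [add_mul, one_mul, Finset.sum_range_add, ih]
    simp_rw [h]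
    push_cast; ring

lemma e2_add (s t : ℝ) : e2 (s + t) = e2 s * e2 t := by
  unfold e2; rw [← Complex.exp_add]; push_cast; ring_nf

lemma e2_std (q : ℕ) [NeZero q] (n : ℤ) :
    e2 ((n : ℝ) / (q : ℝ)) = ZMod.stdAddChar (n : ZMod q) := by
  rw [ZMod.stdAddChar_coe]; unfold e2; push_cast; ring_nf

lemma std_eq_one (q : ℕ) [NeZero q] (n : ℤ) :
    ZMod.stdAddChar (n : ZMod q) = 1 ↔ (q : ℤ) ∣ n := by
  rw [← ZMod.intCast_zmod_eq_zero_iff_dvd]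
  constructor
  · intro h
    apply ZMod.injective_stdAddChar
    rw [h, AddChar.map_zero_eq_one]
  · intro h; rw [h, AddChar.map_zero_eq_one]

lemma card_ann (q : ℕ) [NeZero q] (β : ℤ) :
    (univ.filter fun h : ZMod q => (β : ZMod q) * h = 0).card ≤ Int.gcd (q : ℤ) β := by
  have hq : 0 < q := Nat.pos_of_neZero q
  have hg : 0 < Int.gcd (q : ℤ) β := Int.gcd_pos_of_ne_zero_left _ (by exact_mod_cast hq.ne')
  set g := Int.gcd (q : ℤ) β with hgdef
  obtain ⟨m, hm⟩ : (g : ℤ) ∣ q := Int.gcd_dvd_left ..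
  obtain ⟨b, hb⟩ : (g : ℤ) ∣ β := Int.gcd_dvd_right ..
  have hg0 : (g : ℤ) ≠ 0 := by exact_mod_cast hg.ne'
  have hcop : IsCoprime m b := by
    rw [Int.isCoprime_iff_gcd_eq_one]
    have h := Int.gcd_div_gcd_div_gcd (i := (q : ℤ)) (j := β) hg
    rw [← hgdef, hm, hb, Int.mul_ediv_cancel_left _ hg0, Int.mul_ediv_cancel_left _ hg0] at h
    exact h
  have hm0 : 0 < m := by
    have : (0 : ℤ) < g * m := by rw [← hm]; exact_mod_cast hq
    exact pos_of_mul_pos_right this (by positivity)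
  calc _ ≤ ((range g).image fun j : ℕ => ((m * j : ℤ) : ZMod q)).card := by
        apply Finset.card_le_card
        intro h hh
        simp only [mem_filter, mem_univ, true_and] at hh
        simp only [mem_image, mem_range]
        have h1 : (q : ℤ) ∣ β * (h.val : ℤ) := by
          rw [← ZMod.intCast_zmod_eq_zero_iff_dvd]
          simpa using hh
        have h2 : m ∣ (h.val : ℤ) := by
          rw [hm, hb, mul_assoc] at h1
          exact hcop.dvd_of_dvd_mul_left (Int.dvd_of_mul_dvd_mul_left hg0 h1)
        obtain ⟨j, hj⟩ := h2
        have hj0 : 0 ≤ j := by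
          by_contra hlt
          push Not at hlt
          have : m * j < 0 := mul_neg_of_pos_of_neg hm0 hlt
          omega
        lift j to ℕ using hj0
        refine ⟨j, ?_, ?_⟩
        · have hlt : (h.val : ℤ) < q := by exact_mod_cast ZMod.val_lt h
          rw [hj, hm, mul_comm (g : ℤ)] at hlt
          exact_mod_cast lt_of_mul_lt_mul_left hlt hm0.le
        · rw [← hj]; simp
    _ ≤ (range g).card := Finset.card_image_le
    _ = g := by simp

lemma gauss_sq_le (q : ℕ) [NeZero q] (hodd : Odd q) (α β : ℤ) :
    ‖∑ x : ZMod q, ZMod.stdAddChar (2 * x * (α : ZMod _) + x ^ 2 * (β : ZMod _))‖ ^ 2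
      ≤ (q : ℝ) * (Int.gcd (q : ℤ) β : ℝ) := by
  set ψ : AddChar (ZMod q) ℂ := ZMod.stdAddChar with hψ
  have h2 : IsUnit (2 : ZMod q) := by
    have : IsUnit ((2 : ℕ) : ZMod q) := (ZMod.isUnit_iff_coprime 2 q).2 (Nat.coprime_two_left.2 hodd)
    exact_mod_cast this
  set f : ZMod q → ZMod q := fun x => 2 * x * (α : ZMod q) + x ^ 2 * (β : ZMod q) with hf
  have key : ((‖∑ x : ZMod q, ψ (f x)‖ : ℂ)) ^ 2
      = ∑ h ∈ univ.filter (fun h : ZMod q => (β : ZMod q) * h = 0), ψ (f h) * q := by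
    rw [← Complex.mul_conj', map_sum, Finset.sum_mul_sum, Finset.sum_comm]
    have : ∀ y : ZMod q, ∑ x : ZMod q, ψ (f x) * (starRingEnd ℂ) (ψ (f y))
        = ∑ h : ZMod q, ψ (f h) * ψ (y * (2 * (β * h))) := by
      intro y
      rw [← Equiv.sum_comp (Equiv.addLeft y)]
      refine Finset.sum_congr rfl fun h _ => ?_
      rw [← AddChar.map_neg_eq_conj, ← AddChar.map_add_eq_mul, ← AddChar.map_add_eq_mul]
      congr 1
      simp only [hf, Equiv.coe_addLeft]
      ring
    simp_rw [this]
    rw [Finset.sum_comm, Finset.sum_filter]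
    refine Finset.sum_congr rfl fun h _ => ?_
    rw [← Finset.mul_sum, AddChar.sum_mulShift _ (ZMod.isPrimitive_stdAddChar q)]
    simp only [h2.mul_right_eq_zero]
    split_ifs <;> simp [ZMod.card]
  have : ‖((‖∑ x : ZMod q, ψ (f x)‖ : ℂ)) ^ 2‖ ≤ (q : ℝ) * (Int.gcd (q : ℤ) β : ℝ) := by
    rw [key]
    refine (norm_sum_le _ _).trans ?_
    have : ∀ h : ZMod q, ‖ψ (f h) * (q : ℂ)‖ = q := by
      intro h; rw [norm_mul, AddChar.norm_apply]; simp
    simp_rw [this]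
    rw [Finset.sum_const, nsmul_eq_mul, mul_comm]
    gcongr
    exact card_ann q β
  simpa using this

lemma gauss_zero (q : ℕ) [NeZero q] (hodd : Odd q) (α β : ℤ)
    (h : ¬ (Int.gcd (q : ℤ) β : ℤ) ∣ α) :
    ∑ x : ZMod q, ZMod.stdAddChar (2 * x * (α : ZMod _) + x ^ 2 * (β : ZMod _)) = 0 := by
  have hq : 0 < q := Nat.pos_of_neZero q
  have hg : 0 < Int.gcd (q : ℤ) β := Int.gcd_pos_of_ne_zero_left _ (by exact_mod_cast hq.ne')
  set g := Int.gcd (q : ℤ) β with hgdef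
  obtain ⟨m, hm⟩ : (g : ℤ) ∣ q := Int.gcd_dvd_left ..
  obtain ⟨b, hb⟩ : (g : ℤ) ∣ β := Int.gcd_dvd_right ..
  have hg0 : (g : ℤ) ≠ 0 := by exact_mod_cast hg.ne'
  have hm0 : m ≠ 0 := by rintro rfl; simp at hm; omega
  have hmb : (m : ZMod q) * β = 0 := by
    rw [← Int.cast_mul, ZMod.intCast_zmod_eq_zero_iff_dvd, hb, hm]
    exact ⟨b, by ring⟩
  have hne : ZMod.stdAddChar ((2 * m * α : ℤ) : ZMod q) ≠ (1 : ℂ) := by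
    rw [Ne, std_eq_one, hm]
    intro hd
    apply h
    have h1 : (g : ℤ) ∣ 2 * α := by
      apply Int.dvd_of_mul_dvd_mul_left hm0
      convert hd using 1 <;> ring
    have hgo : Odd g := by
      have : g ∣ q := Int.natCast_dvd_natCast.1 (Dvd.intro m hm.symm)
      exact hodd.of_dvd_nat this
    refine IsCoprime.dvd_of_dvd_mul_left ?_ h1
    exact_mod_cast (Nat.isCoprime_iff_coprime (m := g) (n := 2)).2 (Nat.coprime_two_right.2 hgo)
  set S := ∑ x : ZMod q, ZMod.stdAddChar (2 * x * (α : ZMod _) + x ^ 2 * (β : ZMod _)) with hS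
  have : S = ZMod.stdAddChar ((2 * m * α : ℤ) : ZMod q) * S := by
    conv_lhs => rw [hS, ← Equiv.sum_comp (Equiv.addLeft (m : ZMod q))]
    rw [hS, Finset.mul_sum]
    refine Finset.sum_congr rfl fun x _ => ?_
    rw [← AddChar.map_add_eq_mul]
    congr 1
    simp only [Equiv.coe_addLeft]
    push_cast
    linear_combination ((m : ZMod q) + 2 * x) * hmb
  by_contra hS0
  exact hne (mul_right_cancel₀ hS0 (by rw [one_mul]; exact this.symm))

lemma gaussSum_le (p : ℕ) [Fact p.Prime] (χ : MulChar (ZMod p) ℂ) (ψ : AddChar (ZMod p) ℂ)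
    (hψ : ψ ≠ 1) : ‖gaussSum χ ψ‖ ≤ Real.sqrt p := by
  apply Real.le_sqrt_of_sq_le
  by_cases hχ : χ = 1
  · rw [hχ, gaussSum_one_left hψ]
    simp
    exact (Fact.out : p.Prime).one_lt.le
  · have h := gaussSum_mul_gaussSum_eq_card hχ (AddChar.IsPrimitive.of_ne_one hψ)
    rw [← star_gaussSum_eq] at h
    have h2 := congrArg norm h
    rw [norm_mul, norm_star, ZMod.card] at h2
    rw [sq, h2]
    simp

/-- the sum over `c` -/
noncomputable def TT (p k : ℕ) (β : ℤ) : ℂ :=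
  ∑ c ∈ range (p ^ k), ((jacobiSym (c : ℤ) (p ^ k) : ℤ) : ℂ) *
    e2 (((-(c : ℤ) * β : ℤ) : ℝ) / ((p ^ k : ℕ) : ℝ))

lemma jac_per (p k : ℕ) (m n : ℤ) (h : (p : ℤ) ∣ m - n) :
    jacobiSym m (p ^ k) = jacobiSym n (p ^ k) := by
  rw [jacobiSym.pow_right, jacobiSym.pow_right, jacobiSym.mod_left m p, jacobiSym.mod_left n p,
    Int.emod_eq_emod_iff_emod_sub_eq_zero.2 (Int.emod_eq_zero_of_dvd h)]

lemma TT_le_triv (p k : ℕ) (hp : 0 < p) (β : ℤ) : ‖TT p k β‖ ≤ (p : ℝ) ^ k := by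
  have : NeZero (p ^ k) := ⟨(pow_pos hp k).ne'⟩
  unfold TT
  refine (norm_sum_le _ _).trans ?_
  have : ∀ c ∈ range (p ^ k), ‖((jacobiSym (c : ℤ) (p ^ k) : ℤ) : ℂ) *
    e2 (((-(c : ℤ) * β : ℤ) : ℝ) / ((p ^ k : ℕ) : ℝ))‖ ≤ 1 := by
    intro c _
    rw [norm_mul, e2_std, AddChar.norm_apply, mul_one]
    rcases jacobiSym.trichotomy (c : ℤ) (p ^ k) with h | h | h <;> simp [h]
  refine (Finset.sum_le_sum this).trans ?_
  simp

lemma TT_zero (p k : ℕ) (hp : 0 < p) (β : ℤ) (h : ¬ (p : ℤ) ^ k ∣ β) : TT p (k + 1) β = 0 := by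
  have : NeZero (p ^ (k + 1)) := ⟨(pow_pos hp _).ne'⟩
  set q := p ^ (k + 1) with hq
  set F : ℤ → ℂ := fun c => ((jacobiSym c q : ℤ) : ℂ) * e2 (((-c * β : ℤ) : ℝ) / (q : ℝ)) with hF
  have hpq : (p : ℤ) ∣ q := by rw [hq]; push_cast; exact dvd_pow_self _ (by omega)
  have hj : ∀ m n : ℤ, (p : ℤ) ∣ m - n → jacobiSym m q = jacobiSym n q := jac_per p (k + 1)
  have hper : ∀ m n : ℤ, (q : ℤ) ∣ m - n → F m = F n := by
    intro m n hmn
    simp only [hF]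
    rw [e2_std, e2_std, hj m n (hpq.trans hmn)]
    congr 2
    have : (m : ZMod q) = n := by
      rw [← sub_eq_zero, ← Int.cast_sub, ZMod.intCast_zmod_eq_zero_iff_dvd]; exact hmn
    push_cast
    rw [this]
  have h1 : TT p (k + 1) β = ∑ c ∈ range q, F c := rfl
  have h2 := sum_range_shift_per q F hper p
  have h3 : ∑ b ∈ range q, F (p + b) = ZMod.stdAddChar ((-p * β : ℤ) : ZMod q) * ∑ c ∈ range q, F c := by
    rw [Finset.mul_sum]
    refine Finset.sum_congr rfl fun c _ => ?_
    simp only [hF]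
    rw [e2_std, e2_std, hj (p + c) c (by simp), mul_left_comm,
      ← AddChar.map_add_eq_mul]
    congr 2
    push_cast; ring
  rw [h1]
  by_contra hS0
  have hne : ZMod.stdAddChar ((-p * β : ℤ) : ZMod q) ≠ (1 : ℂ) := by
    rw [Ne, std_eq_one, hq]
    push_cast
    rw [pow_succ', neg_mul, dvd_neg]
    intro hd
    exact h (Int.dvd_of_mul_dvd_mul_left (by exact_mod_cast hp.ne') hd)
  exact hne (mul_right_cancel₀ hS0 (by rw [one_mul, ← h3, ← h2]))

lemma TT_le (p k : ℕ) (hp : p.Prime) (β : ℤ) (h : ¬ (p : ℤ) ∣ β) :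
    ‖TT p (k + 1) ((p : ℤ) ^ k * β)‖ ≤ (p : ℝ) ^ k * Real.sqrt p := by
  have : Fact p.Prime := ⟨hp⟩
  have : NeZero p := ⟨hp.ne_zero⟩
  have hp0 : (p : ℝ) ≠ 0 := by exact_mod_cast hp.ne_zero
  set χ : MulChar (ZMod p) ℂ := ((quadraticChar (ZMod p)).ringHomComp (Int.castRingHom ℂ)) ^ (k + 1)
    with hχ
  set ψ : AddChar (ZMod p) ℂ := AddChar.mulShift ZMod.stdAddChar ((-β : ℤ) : ZMod p) with hψ
  have hβ : ((-β : ℤ) : ZMod p) ≠ 0 := by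
    rw [Ne, ZMod.intCast_zmod_eq_zero_iff_dvd, dvd_neg]; exact h
  have hψ1 : ψ ≠ 1 := ZMod.isPrimitive_stdAddChar p hβ
  have hterm : TT p (k + 1) ((p : ℤ) ^ k * β) =
      ∑ c ∈ range (p ^ k * p), χ ((c : ℤ) : ZMod p) * ψ ((c : ℤ) : ZMod p) := by
    unfold TT
    rw [← pow_succ]
    refine Finset.sum_congr rfl fun c _ => ?_
    congr 1
    · rw [hχ, MulChar.pow_apply' _ (by omega), MulChar.ringHomComp_apply, jacobiSym.pow_right,
        ← jacobiSym.legendreSym.to_jacobiSym]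
      simp [legendreSym]
    · rw [hψ, AddChar.mulShift_apply, ← Int.cast_mul, ← e2_std]
      congr 1
      push_cast
      field_simp
      ring
  rw [hterm, sum_range_mul_per p (p ^ k)]
  · rw [sum_range_zmod' p (fun x => χ x * ψ x), norm_mul]
    have := gaussSum_le p χ ψ hψ1
    unfold gaussSum at this
    simp only [Nat.cast_pow, norm_pow, Complex.norm_natCast]
    gcongr
  · intro n; simp

lemma omega_factor_s14 (p k₁ k₂ : ℕ) (hp : p.Prime) (hk : 1 ≤ k₁) (α β : ℤ) [NeZero (p ^ (k₁ + 2 * k₂))] :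
    omegaSum p k₁ k₂ α β =
      (∑ x : ZMod (p ^ (k₁ + 2 * k₂)), ZMod.stdAddChar (2 * x * (α : ZMod _) + x ^ 2 * (β : ZMod _))) * TT p k₁ β := by
  set q := p ^ (k₁ + 2 * k₂) with hq
  set P := p ^ (2 * k₂) with hP
  have hP0 : 0 < P := pow_pos hp.pos _
  have hPZ : (P : ℤ) ≠ 0 := by exact_mod_cast hP0.ne'
  have hqP : q = p ^ k₁ * P := by rw [hq, hP, pow_add]
  rw [← sum_range_zmod' q, Finset.sum_mul]
  unfold omegaSum
  refine Finset.sum_congr rfl fun a _ => ?_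
  set F : ℤ → ℂ := fun b => if (P : ℤ) ∣ (a : ℤ) ^ 2 - b then
    ((jacobiSym (((a : ℤ) ^ 2 - b) / P) (p ^ k₁) : ℤ) : ℂ) *
      e2 (((2 * a * α + b * β : ℤ) : ℝ) / (q : ℝ)) else 0 with hF
  have hper : ∀ m n : ℤ, (q : ℤ) ∣ m - n → F m = F n := by
    rintro m n ⟨t, ht⟩
    obtain rfl : m = n + q * t := by linarith
    have hd : (P : ℤ) ∣ (a : ℤ) ^ 2 - (n + q * t) ↔ (P : ℤ) ∣ (a : ℤ) ^ 2 - n := by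
      rw [← sub_sub]
      apply dvd_sub_left
      rw [hqP]; push_cast
      exact ⟨p ^ k₁ * t, by ring⟩
    simp only [hF, hd]
    split_ifs with hh
    · congr 1
      · congr 1
        apply jac_per
        obtain ⟨s, hs⟩ := hh
        have : (a : ℤ) ^ 2 - (n + q * t) = P * (s - p ^ k₁ * t) := by
          rw [← sub_sub, hs, hqP]; push_cast; ring
        rw [this, hs, Int.mul_ediv_cancel_left _ hPZ, Int.mul_ediv_cancel_left _ hPZ]
        have : (p : ℤ) ∣ p ^ k₁ := dvd_pow_self _ (by omega)
        rw [sub_sub_cancel_left]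
        exact (this.mul_right t).neg_right
      · rw [e2_std, e2_std]
        congr 1
        push_cast
        simp
    · rfl
  have h1 : (∑ b ∈ range q, if (p : ℤ) ^ (2 * k₂) ∣ ((a : ℤ) ^ 2 - (b : ℤ)) then
      ((jacobiSym (((a : ℤ) ^ 2 - (b : ℤ)) / (p : ℤ) ^ (2 * k₂)) (p ^ k₁) : ℤ) : ℂ) *
        e2 (((2 * a * α + b * β : ℤ) : ℝ) / (p : ℝ) ^ (k₁ + 2 * k₂))
    else 0) = ∑ b ∈ range q, F b := by
    refine Finset.sum_congr rfl fun b _ => ?_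
    simp only [hF, hP, hq]
    push_cast
    rfl
  rw [h1, sum_range_reflect_per q F hper ((a : ℤ) ^ 2)]
  set f : ℤ → ℂ := fun c => ((jacobiSym c (p ^ k₁) : ℤ) : ℂ) *
      e2 (((2 * a * α + ((a : ℤ) ^ 2 - P * c) * β : ℤ) : ℝ) / (q : ℝ)) with hf
  have h2 : ∑ b ∈ range q, F ((a : ℤ) ^ 2 - b) =
      ∑ b ∈ range (p ^ k₁ * P), if (P : ℤ) ∣ (b : ℤ) then f ((b : ℤ) / P) else 0 := by
    rw [← hqP]
    refine Finset.sum_congr rfl fun b _ => ?_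
    simp only [hF, hf, sub_sub_cancel]
    split_ifs with hh
    · rw [Int.mul_ediv_cancel' hh]
    · rfl
  rw [h2, sum_range_dvd _ _ hP0]
  unfold TT
  rw [Finset.mul_sum]
  refine Finset.sum_congr rfl fun c _ => ?_
  simp only [hf]
  rw [mul_left_comm]
  congr 1
  have h3 : (2 * ((a : ℤ) : ZMod q) * α + ((a : ℤ) : ZMod q) ^ 2 * β)
      = ((2 * a * α + a ^ 2 * β : ℤ) : ZMod q) := by push_cast; rfl
  rw [h3, ← e2_std, ← e2_add]
  congr 1
  have hp0 : (p : ℝ) ≠ 0 := by exact_mod_cast hp.ne_zero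
  have hP0' : (P : ℝ) ≠ 0 := by exact_mod_cast hP0.ne'
  rw [hqP]
  push_cast
  field_simp
  rw [hP]
  push_cast
  ring

lemma TT_bound (p k : ℕ) (hp : p.Prime) (β : ℤ) (h : (p : ℤ) ^ k ∣ β) :
    ‖TT p (k + 1) β‖ ≤ Real.sqrt ((p : ℝ) ^ (k + 1) * (Int.gcd ((p : ℤ) ^ (k + 1)) β : ℝ)) := by
  by_cases hd : (p : ℤ) ^ (k + 1) ∣ β
  · have : Int.gcd ((p : ℤ) ^ (k + 1)) β = p ^ (k + 1) := by
      have := (Int.gcd_eq_left_iff_dvd (a := (p : ℤ) ^ (k + 1)) (by positivity)).2 hd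
      exact_mod_cast this
    rw [this]
    push_cast
    rw [Real.sqrt_mul_self (by positivity)]
    exact TT_le_triv p _ hp.pos β
  · obtain ⟨b, rfl⟩ := h
    have hb : ¬ (p : ℤ) ∣ b := by
      intro hb; apply hd; rw [pow_succ]; exact mul_dvd_mul_left _ hb
    refine (TT_le p k hp b hb).trans ?_
    apply Real.le_sqrt_of_sq_le
    rw [mul_pow, Real.sq_sqrt (by positivity)]
    have hle : p ^ k ≤ Int.gcd ((p : ℤ) ^ (k + 1)) ((p : ℤ) ^ k * b) := by
      apply Nat.le_of_dvd
      · exact Int.gcd_pos_of_ne_zero_left _ (pow_ne_zero _ (by exact_mod_cast hp.ne_zero))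
      · have := Int.dvd_coe_gcd (pow_dvd_pow (p : ℤ) (Nat.le_succ k)) (dvd_mul_right ((p : ℤ) ^ k) b)
        exact_mod_cast this
    have hle' : (p : ℝ) ^ k ≤ (Int.gcd ((p : ℤ) ^ (k + 1)) ((p : ℤ) ^ k * b) : ℝ) := by
      exact_mod_cast hle
    calc ((p : ℝ) ^ k) ^ 2 * p = (p : ℝ) ^ (k + 1) * (p : ℝ) ^ k := by ring
      _ ≤ _ := by gcongr

theorem omegaSum_bound :
    ∃ C : ℝ, ∀ p : ℕ, p.Prime → Odd p → ∀ k₁ k₂ : ℕ, 1 ≤ k₁ → ∀ α β : ℤ,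
      (((p : ℤ) ^ (k₁ - 1) ∣ β ∧ (Int.gcd ((p : ℤ) ^ (k₁ + 2 * k₂)) β : ℤ) ∣ α) →
        ‖omegaSum p k₁ k₂ α β‖ ≤ C * (p : ℝ) ^ (k₁ + k₂) *
          Real.sqrt ((Int.gcd ((p : ℤ) ^ (k₁ + 2 * k₂)) β : ℝ) *
            (Int.gcd ((p : ℤ) ^ k₁) β : ℝ))) ∧
      (¬ ((p : ℤ) ^ (k₁ - 1) ∣ β ∧ (Int.gcd ((p : ℤ) ^ (k₁ + 2 * k₂)) β : ℤ) ∣ α) →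
        omegaSum p k₁ k₂ α β = 0) := by
  refine ⟨1, fun p hp hodd k₁ k₂ hk α β => ?_⟩
  have : NeZero (p ^ (k₁ + 2 * k₂)) := ⟨pow_ne_zero _ hp.ne_zero⟩
  have hqodd : Odd (p ^ (k₁ + 2 * k₂)) := hodd.pow
  rw [omega_factor_s14 p k₁ k₂ hp hk]
  obtain ⟨k, rfl⟩ : ∃ k, k₁ = k + 1 := ⟨k₁ - 1, by omega⟩
  simp only [Nat.add_sub_cancel]
  constructor
  · rintro ⟨h1, -⟩
    have hT := TT_bound p k hp β h1
    have hG := Real.le_sqrt_of_sq_le (gauss_sq_le _ hqodd α β)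
    push_cast at hG
    rw [norm_mul]
    refine (mul_le_mul hG hT (norm_nonneg _) (Real.sqrt_nonneg _)).trans (le_of_eq ?_)
    rw [← Real.sqrt_mul (by positivity), one_mul]
    rw [← Real.sqrt_sq (show (0 : ℝ) ≤ (p : ℝ) ^ (k + 1 + k₂) by positivity),
      ← Real.sqrt_mul (by positivity)]
    congr 1
    ring
  · intro h
    rw [not_and_or] at h
    rcases h with h | h
    · rw [TT_zero p k hp.pos β h, mul_zero]
    · rw [gauss_zero _ hqodd α β (by push_cast; exact h), zero_mul]
end

section
/- Let Φ : (0,∞) → ℂ be a smooth function such that sup_{x>0} x^a·|Φ^{(b)}(x)| < ∞ for all a, b ∈ ℕ. Let α ∈ ℤ and M, N ∈ ℕ. Then there exists a constant C, depending only on Φ, α, M and N, such that for every smooth function G : ℝ → ℂ with support contained in [1/4, 5/4], every real X ≥ 1, all positive integers l, f, every ξ ∈ ℤ, every nonzero ν ∈ ℤ, and every x ∈ (−1, 1): | ∫_0^∞ G(y/X) · y^{α/2} · Φ( lf²/(2√y·√(1−x²)) ) · e( −(2xξ√y + yν)/(4lf²) ) dy | ≤ C · ‖G‖_{M,1} ·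 ( X^{1+α/2} / (|ν|^M · X^{M/2}) ) · [ (lf²/√X)^M + |ξ|^M ] · ( √X·√(1−x²)/(lf²) )^N. -/
open MeasureTheory

/-- The Sobolev `W^{M,1}`-norm `‖G‖_{M,1} = ∑_{j=0}^M ∫ |G^{(j)}(t)| dt`. -/
noncomputable def sobolevNorm (M : ℕ) (G : ℝ → ℂ) : ℝ :=
  ∑ j ∈ Finset.range (M + 1), ∫ t : ℝ, ‖iteratedDeriv j G t‖

/-- Derivative bounds on `[1/4,5/4]`. -/
def DB {E : Type} [NormedAddCommGroup E] [NormedSpace ℝ E] (M : ℕ) (K : ℝ) (f : ℝ → E) : Prop :=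
  ContDiffOn ℝ (⊤ : ℕ∞) f (Set.Ioi 0) ∧ ∀ k ≤ M, ∀ t ∈ Set.Icc (1/4 : ℝ) (5/4),
    ‖iteratedFDerivWithin ℝ k f (Set.Ioi 0) t‖ ≤ K

lemma udS : UniqueDiffOn ℝ (Set.Ioi (0:ℝ)) := isOpen_Ioi.uniqueDiffOn

lemma TS {t : ℝ} (ht : t ∈ Set.Icc (1/4 : ℝ) (5/4)) : t ∈ Set.Ioi (0:ℝ) := by
  have := ht.1; simp only [Set.mem_Ioi]; linarith

lemma DB.mul {M : ℕ} {K L : ℝ} {f g : ℝ → ℂ} (hf : DB M K f) (hg : DB M L g)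
    (hK : 0 ≤ K) (hL : 0 ≤ L) :
    DB M (2 ^ M * (K * L)) (fun t => f t * g t) := by
  refine ⟨hf.1.mul hg.1, fun k hk t ht => ?_⟩
  refine (norm_iteratedFDerivWithin_mul_le hf.1 hg.1 udS (TS ht) (n := k) (by
    exact_mod_cast le_top)).trans ?_
  calc _ ≤ ∑ i ∈ Finset.range (k + 1), (k.choose i : ℝ) * (K * L) := by
        apply Finset.sum_le_sum
        intro i hi
        have hi' : i ≤ k := by simpa [Nat.lt_succ_iff] using hi
        rw [mul_assoc]
        gcongr
        · exact hf.2 i (hi'.trans hk) t ht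
        · exact hg.2 (k - i) ((Nat.sub_le _ _).trans hk) t ht
    _ = 2 ^ k * (K * L) := by
        rw [← Finset.sum_mul]
        congr 1
        exact_mod_cast Nat.sum_range_choose k
    _ ≤ _ := by
        gcongr
        norm_num

lemma exists_DB {E : Type} [NormedAddCommGroup E] [NormedSpace ℝ E] (M : ℕ) {f : ℝ → E}
    (hf : ContDiffOn ℝ (⊤ : ℕ∞) f (Set.Ioi 0)) : ∃ K, 1 ≤ K ∧ DB M K f := by
  have : ∀ k : ℕ, ∃ K, 0 ≤ K ∧ ∀ t ∈ Set.Icc (1/4 : ℝ) (5/4),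
      ‖iteratedFDerivWithin ℝ k f (Set.Ioi 0) t‖ ≤ K := by
    intro k
    have hc := hf.continuousOn_iteratedFDerivWithin (m := k) (by exact_mod_cast le_top) udS
    obtain ⟨K, hK⟩ := isCompact_Icc.exists_bound_of_continuousOn
      (hc.mono (fun t (ht : t ∈ Set.Icc (1/4 : ℝ) (5/4)) => TS ht))
    exact ⟨max K 0, le_max_right _ _, fun t ht => (hK t ht).trans (le_max_left _ _)⟩
  choose K hK0 hK using this
  refine ⟨1 + ∑ k ∈ Finset.range (M + 1), K k, ?_, hf, fun k hk t ht => (hK k t ht).trans ?_⟩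
  · have := Finset.sum_nonneg (s := Finset.range (M + 1)) (fun k _ => hK0 k)
    linarith
  · have := Finset.single_le_sum (s := Finset.range (M + 1)) (f := K) (fun k _ => hK0 k)
      (Finset.mem_range.2 (Nat.lt_succ_of_le hk))
    linarith

lemma DB.comp {M : ℕ} {C D : ℝ} {g : ℝ → ℂ} {f : ℝ → ℝ} (hf : DB M D f) (hD : 1 ≤ D)
    (hC0 : 0 ≤ C)
    (hst : Set.MapsTo f (Set.Ioi 0) (Set.Ioi 0))
    (hg : ContDiffOn ℝ (⊤ : ℕ∞) g (Set.Ioi 0))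
    (hC : ∀ i ≤ M, ∀ t ∈ Set.Icc (1/4 : ℝ) (5/4),
      ‖iteratedFDerivWithin ℝ i g (Set.Ioi 0) (f t)‖ ≤ C) :
    DB M (M.factorial * C * D ^ M) (fun t => g (f t)) := by
  refine ⟨hg.comp hf.1 hst, fun k hk t ht => ?_⟩
  refine (norm_iteratedFDerivWithin_comp_le hg hf.1 (n := k) (by exact_mod_cast le_top)
    udS udS hst (TS ht) (C := C) (D := D) (fun i hi => hC i (hi.trans hk) t ht)
    (fun i hi hi' => (hf.2 i (hi'.trans hk) t ht).trans
      (le_self_pow₀ hD (by omega)))).trans ?_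
  have : (k.factorial : ℝ) ≤ M.factorial := by exact_mod_cast Nat.factorial_le hk
  gcongr

lemma sqrt_cd : ContDiffOn ℝ (⊤ : ℕ∞) (fun t : ℝ => √t) (Set.Ioi 0) :=
  contDiffOn_id.sqrt (fun _ hx => ne_of_gt hx)

lemma isqrt_cd : ContDiffOn ℝ (⊤ : ℕ∞) (fun t : ℝ => (√t)⁻¹) (Set.Ioi 0) :=
  sqrt_cd.inv (fun _ hx => (Real.sqrt_pos.2 hx).ne')

lemma iterExp (c : ℂ) (n : ℕ) : iteratedDeriv n (fun s : ℝ => Complex.exp (c * s)) =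
    fun s : ℝ => c ^ n * Complex.exp (c * s) := by
  induction n with
  | zero => simp
  | succ n ih =>
    rw [iteratedDeriv_succ, ih]
    funext s
    have h : HasDerivAt (fun s : ℝ => c * (s : ℂ)) c s := by
      simpa using (Complex.ofRealCLM.hasDerivAt (x := s)).const_mul c
    rw [(h.cexp.const_mul (c ^ n)).deriv]
    ring

lemma exp_DB (M : ℕ) : ∃ C, 0 ≤ C ∧ ∀ u : ℝ,
    DB M (C * (1 + |u|) ^ M) (fun t => e2 (-(u * √t))) := by
  obtain ⟨D, hD1, hD⟩ := exists_DB M sqrt_cd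
  refine ⟨M.factorial * (2 * Real.pi) ^ M * D ^ M, by positivity, fun u => ?_⟩
  have hfun : (fun s : ℝ => e2 (-(u * s))) =
      fun s : ℝ => Complex.exp ((-(2 * Real.pi * Complex.I * u)) * s) := by
    funext s
    simp only [e2]
    congr 1
    push_cast
    ring
  have key := DB.comp (C := (2 * Real.pi) ^ M * (1 + |u|) ^ M) (g := fun s => e2 (-(u * s))) hD hD1
    (by positivity) (fun t ht => Real.sqrt_pos.2 ht)
    (by
      rw [hfun]
      apply ContDiff.contDiffOn
      have : ContDiff ℝ (⊤ : ℕ∞) (fun s : ℝ => (s : ℂ)) := Complex.ofRealCLM.contDiff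
      exact (contDiff_const.mul this).cexp) (by
      intro i hi t ht
      have hs : √t ∈ Set.Ioi (0:ℝ) := Real.sqrt_pos.2 (TS ht)
      rw [norm_iteratedFDerivWithin_eq_norm_iteratedDerivWithin,
        iteratedDerivWithin_of_isOpen isOpen_Ioi hs, hfun, iterExp]
      have h1 : ‖Complex.exp (-(2 * Real.pi * Complex.I * u) * (√t : ℝ))‖ = 1 := by
        rw [Complex.norm_exp]
        simp
      rw [norm_mul, h1, norm_pow, mul_one, ← mul_pow]
      have h2 : ‖-(2 * Real.pi * Complex.I * (u:ℂ))‖ = 2 * Real.pi * |u| := by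
        simp [abs_of_pos Real.pi_pos]
      rw [h2]
      have hpi := Real.pi_gt_three
      have hu := abs_nonneg u
      calc (2 * Real.pi * |u|) ^ i ≤ (2 * Real.pi * (1 + |u|)) ^ i := by
            gcongr; linarith
        _ ≤ _ := by
            apply pow_le_pow_right₀ _ hi
            nlinarith)
  convert key using 1
  ring

lemma phi_DB (Φ : ℝ → ℂ)
    (hΦ : ContDiffOn ℝ (⊤ : ℕ∞) Φ (Set.Ioi 0))
    (hΦdecay : ∀ a b : ℕ, ∃ B : ℝ, ∀ x ∈ Set.Ioi (0 : ℝ),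
      x ^ a * ‖iteratedDerivWithin b Φ (Set.Ioi 0) x‖ ≤ B) (M N : ℕ) :
    ∃ C, 0 ≤ C ∧ ∀ w : ℝ, 0 < w → DB M (C * w⁻¹ ^ N) (fun t => Φ (w * (√t)⁻¹)) := by
  obtain ⟨D, hD1, hD⟩ := exists_DB M isqrt_cd
  choose B hB using hΦdecay
  have hB0 : ∀ a b, 0 ≤ B a b := fun a b => le_trans (by positivity) (hB a b 1 (by simp))
  set C0 : ℝ := ∑ i ∈ Finset.range (M + 1), B (i + N) i * 2 ^ (i + N) with hC0
  have hC0' : 0 ≤ C0 := Finset.sum_nonneg (fun i _ => mul_nonneg (hB0 _ _) (by positivity))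
  refine ⟨M.factorial * C0 * D ^ M, by positivity, fun w hw => ?_⟩
  have hmaps : Set.MapsTo (fun s : ℝ => w * s) (Set.Ioi 0) (Set.Ioi 0) :=
    fun s hs => mul_pos hw hs
  have key := DB.comp (C := C0 * w⁻¹ ^ N) (g := fun s => Φ (w * s)) hD hD1
    (by positivity) (fun t ht => inv_pos.2 (Real.sqrt_pos.2 ht))
    (hΦ.comp (contDiff_const.mul contDiff_id).contDiffOn hmaps) (by
      intro i hi t ht
      have hs0 : 0 < √t := Real.sqrt_pos.2 (TS ht)
      have hs : (√t)⁻¹ ∈ Set.Ioi (0:ℝ) := inv_pos.2 hs0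
      have hs2 : √t ≤ 2 := by
        rw [Real.sqrt_le_left (by norm_num)]
        have := ht.2
        linarith
      rw [norm_iteratedFDerivWithin_eq_norm_iteratedDerivWithin,
        iteratedDerivWithin_comp_const_smul hs udS (hΦ.of_le (by exact_mod_cast le_top)) w hmaps,
        norm_smul, Real.norm_of_nonneg (by positivity)]
      have hb := hB (i + N) i (w * (√t)⁻¹) (hmaps hs)
      set A := ‖iteratedDerivWithin i Φ (Set.Ioi 0) (w * (√t)⁻¹)‖ with hA
      have hA0 : 0 ≤ A := norm_nonneg _
      have e1 : w ^ i * A = (w * (√t)⁻¹) ^ (i + N) * A * (√t ^ (i + N)) * w⁻¹ ^ N := by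
        have : w ≠ 0 := hw.ne'
        clear_value A
        simp only [mul_pow, inv_pow, pow_add]
        field_simp
      rw [e1]
      gcongr
      calc _ ≤ B (i + N) i * 2 ^ (i + N) := by
            have := hB0 (i + N) i
            gcongr
        _ ≤ C0 := Finset.single_le_sum (f := fun i => B (i + N) i * 2 ^ (i + N))
            (fun i _ => mul_nonneg (hB0 _ _) (by positivity))
            (Finset.mem_range.2 (Nat.lt_succ_of_le hi)))
  convert key using 1
  ring

lemma fourier_bound {M : ℕ} {K : ℝ} (hK : 0 ≤ K) {A G : ℝ → ℂ} (hA : DB M K A)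
    (hG : ContDiff ℝ (⊤ : ℕ∞) G) (hs : Function.support G ⊆ Set.Icc (1/4 : ℝ) (5/4)) (v : ℝ) :
    (2 * Real.pi * |v|) ^ M * ‖∫ t : ℝ, G t * A t * e2 (-(v * t))‖ ≤
      2 ^ M * K * sobolevNorm M G := by
  set F : ℝ → ℂ := fun t => G t * A t with hF
  have hsF : Function.support F ⊆ Set.Icc (1/4 : ℝ) (5/4) := fun t ht => hs (by
    intro h; exact ht (by simp [hF, h]))
  have htF : tsupport F ⊆ Set.Icc (1/4 : ℝ) (5/4) := closure_minimal hsF isClosed_Icc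
  have htG : tsupport G ⊆ Set.Icc (1/4 : ℝ) (5/4) := closure_minimal hs isClosed_Icc
  have hcF : HasCompactSupport F := isCompact_Icc.of_isClosed_subset isClosed_closure htF
  have hcG : HasCompactSupport G := isCompact_Icc.of_isClosed_subset isClosed_closure htG
  have hFS : ContDiffOn ℝ (⊤ : ℕ∞) F (Set.Ioi 0) := hG.contDiffOn.mul hA.1
  have hFd : ContDiff ℝ (⊤ : ℕ∞) F := by
    rw [contDiff_iff_contDiffAt]
    intro t
    by_cases ht : t ∈ tsupport F
    · exact hFS.contDiffAt (isOpen_Ioi.mem_nhds (TS (htF ht)))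
    · exact (contDiffAt_const (c := (0:ℂ))).congr_of_eventuallyEq
        (notMem_tsupport_iff_eventuallyEq.1 ht)
  have hint : ∀ {H : ℝ → ℂ}, ContDiff ℝ (⊤ : ℕ∞) H → HasCompactSupport H → ∀ n : ℕ,
      Integrable (iteratedDeriv n H) := by
    intro H hH hc n
    apply (hH.continuous_iteratedDeriv n (by exact_mod_cast le_top)).integrable_of_hasCompactSupport
    rw [iteratedDeriv_eq_equiv_comp]
    exact (hc.iteratedFDeriv (𝕜 := ℝ) n).comp_left (map_zero _)
  have h1 := Real.fourier_iteratedDeriv (n := M) hFd (fun n _ => hint hFd hcF n)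
    (by exact_mod_cast le_top)
  have h2 := congrFun h1 v
  have h3 : FourierTransform.fourier F v = ∫ t : ℝ, G t * A t * e2 (-(v * t)) := by
    rw [Real.fourier_eq']
    congr 1
    funext t
    rw [smul_eq_mul, mul_comm]
    congr 1
    simp only [e2]
    congr 1
    simp
    ring
  have h4 : ‖FourierTransform.fourier (iteratedDeriv M F) v‖ ≤ ∫ t, ‖iteratedDeriv M F t‖ := by
    rw [Real.fourier_eq']
    refine (norm_integral_le_integral_norm _).trans (le_of_eq ?_)
    congr 1
    funext t
    rw [norm_smul, Complex.norm_exp]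
    simp
  rw [h2, h3, norm_smul, norm_pow] at h4
  have h5 : ‖(2 * Real.pi * Complex.I * (v:ℂ))‖ = 2 * Real.pi * |v| := by
    simp [abs_of_pos Real.pi_pos]
  rw [h5] at h4
  refine h4.trans ?_
  have hpt : ∀ t, ‖iteratedDeriv M F t‖ ≤
      2 ^ M * K * ∑ j ∈ Finset.range (M + 1), ‖iteratedDeriv j G t‖ := by
    intro t
    by_cases ht : t ∈ Set.Icc (1/4 : ℝ) (5/4)
    · rw [← iteratedDerivWithin_of_isOpen isOpen_Ioi (TS ht),
        ← norm_iteratedFDerivWithin_eq_norm_iteratedDerivWithin]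
      refine (norm_iteratedFDerivWithin_mul_le hG.contDiffOn hA.1 udS (TS ht) (n := M) (by
        exact_mod_cast le_top)).trans ?_
      rw [Finset.mul_sum]
      apply Finset.sum_le_sum
      intro i hi
      rw [norm_iteratedFDerivWithin_eq_norm_iteratedDerivWithin,
        iteratedDerivWithin_of_isOpen isOpen_Ioi (TS ht)]
      have hc : (M.choose i : ℝ) ≤ 2 ^ M := by exact_mod_cast Nat.choose_le_two_pow M i
      have hb := hA.2 (M - i) (Nat.sub_le _ _) t ht
      calc _ ≤ 2 ^ M * ‖iteratedDeriv i G t‖ * K := by gcongr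
        _ = _ := by ring
    · have : iteratedFDeriv ℝ M F t = 0 := by
        by_contra h
        exact ht (htF (support_iteratedFDeriv_subset M h))
      rw [← norm_iteratedFDeriv_eq_norm_iteratedDeriv, this, norm_zero]
      positivity
  have hsum : Integrable (fun t => ∑ j ∈ Finset.range (M + 1), ‖iteratedDeriv j G t‖) :=
    integrable_finsetSum _ (fun j _ => (hint hG hcG j).norm)
  calc _ ≤ ∫ t, 2 ^ M * K * ∑ j ∈ Finset.range (M + 1), ‖iteratedDeriv j G t‖ :=
        integral_mono (hint hFd hcF M).norm (hsum.const_mul _) hpt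
    _ = _ := by
        rw [integral_const_mul, integral_finsetSum _ (fun j _ => (hint hG hcG j).norm)]
        rfl

/-- Bound on the oscillatory integral
`V_{l,f,α}(ξ,ν,X) = ∫_0^∞ G(y/X)·y^{α/2}·Φ(lf²/(2√y√(1−x²)))·e(−(2xξ√y+yν)/(4lf²)) dy`
for a Schwartz-type function `Φ` on `(0,∞)`. -/
theorem oscillatory_integral_bound (Φ : ℝ → ℂ)
    (hΦ : ContDiffOn ℝ (⊤ : ℕ∞) Φ (Set.Ioi 0))
    (hΦdecay : ∀ a b : ℕ, ∃ B : ℝ, ∀ x ∈ Set.Ioi (0 : ℝ),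
      x ^ a * ‖iteratedDerivWithin b Φ (Set.Ioi 0) x‖ ≤ B)
    (α : ℤ) (M N : ℕ) :
    ∃ C : ℝ, ∀ G : ℝ → ℂ, ContDiff ℝ (⊤ : ℕ∞) G →
      Function.support G ⊆ Set.Icc (1/4 : ℝ) (5/4) →
      ∀ X : ℝ, 1 ≤ X → ∀ l f : ℕ, 0 < l → 0 < f → ∀ ξ ν : ℤ, ν ≠ 0 →
        ∀ x : ℝ, x ∈ Set.Ioo (-1 : ℝ) 1 →
        ‖∫ y in Set.Ioi (0 : ℝ),
            G (y / X) * ((y ^ ((α : ℝ) / 2) : ℝ) : ℂ) *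
              Φ ((l * f ^ 2 : ℝ) / (2 * Real.sqrt y * Real.sqrt (1 - x ^ 2))) *
              e2 (-(2 * x * (ξ : ℝ) * Real.sqrt y + y * (ν : ℝ)) /
                (4 * (l : ℝ) * (f : ℝ) ^ 2))‖
          ≤ C * sobolevNorm M G *
              (X ^ (1 + (α : ℝ) / 2) / (|(ν : ℝ)| ^ M * X ^ ((M : ℝ) / 2))) *
              (((l * f ^ 2 : ℝ) / Real.sqrt X) ^ M + |(ξ : ℝ)| ^ M) *
              (Real.sqrt X * Real.sqrt (1 - x ^ 2) / (l * f ^ 2 : ℝ)) ^ N := by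
  obtain ⟨Ka, hKa1, hKa⟩ := exists_DB M (f := fun t : ℝ => ((t ^ ((α : ℝ) / 2) : ℝ) : ℂ))
    (Complex.ofRealCLM.contDiff.comp_contDiffOn
      (contDiffOn_id.rpow_const_of_ne (fun _ hx => ne_of_gt hx)))
  obtain ⟨Cp, hCp0, hCp⟩ := phi_DB Φ hΦ hΦdecay M N
  obtain ⟨Ce, hCe0, hCe⟩ := exp_DB M
  have hKa0 : 0 ≤ Ka := by linarith
  refine ⟨2 ^ M * 4 ^ M * 2 ^ M * 2 ^ M * Ka * Cp * 2 ^ N * Ce * 2 ^ M, ?_⟩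
  intro G hG hs X hX l f hl hf ξ ν hν x hx
  have hX0 : 0 < X := by linarith
  have hl' : (0:ℝ) < l := by exact_mod_cast hl
  have hf' : (0:ℝ) < f := by exact_mod_cast hf
  have hLpos : (0:ℝ) < l * f ^ 2 := by positivity
  have hν' : 0 < |(ν : ℝ)| := abs_pos.2 (by exact_mod_cast hν)
  have hq : 0 < √(1 - x ^ 2) := Real.sqrt_pos.2 (by nlinarith [hx.1, hx.2])
  set q := √(1 - x ^ 2) with hqdef
  set L : ℝ := l * f ^ 2 with hL
  have hr : 0 < √X := Real.sqrt_pos.2 hX0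
  set r := √X with hrdef
  have hrX : X = r ^ 2 := (Real.sq_sqrt hX0.le).symm
  set w : ℝ := L / (2 * r * q) with hw
  set u : ℝ := x * ξ * r / (2 * L) with hu
  set v : ℝ := X * ν / (4 * L) with hv
  have hw0 : 0 < w := by positivity
  set A : ℝ → ℂ := fun t => ((t ^ ((α : ℝ) / 2) : ℝ) : ℂ) * Φ (w * (√t)⁻¹) * e2 (-(u * √t)) with hA
  set K : ℝ := 2 ^ M * ((2 ^ M * (Ka * (Cp * w⁻¹ ^ N))) * (Ce * (1 + |u|) ^ M)) with hK
  have hADB : DB M K A :=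
    (hKa.mul (hCp w hw0) hKa0 (by positivity)).mul (hCe u) (by positivity) (by positivity)
  have hK0 : 0 ≤ K := by positivity
  have hFB := fourier_bound hK0 hADB hG hs v
  set J : ℂ := ∫ t : ℝ, G t * A t * e2 (-(v * t)) with hJ
  have hsub : ∫ y in Set.Ioi (0 : ℝ),
            G (y / X) * ((y ^ ((α : ℝ) / 2) : ℝ) : ℂ) *
              Φ (L / (2 * Real.sqrt y * q)) *
              e2 (-(2 * x * (ξ : ℝ) * Real.sqrt y + y * (ν : ℝ)) /
                (4 * (l : ℝ) * (f : ℝ) ^ 2)) = ((X * X ^ ((α : ℝ) / 2) : ℝ) : ℂ) * J := by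
    have h0 := integral_comp_mul_left_Ioi' (fun y : ℝ => G (y / X) * ((y ^ ((α : ℝ) / 2) : ℝ) : ℂ) *
              Φ (L / (2 * Real.sqrt y * q)) *
              e2 (-(2 * x * (ξ : ℝ) * Real.sqrt y + y * (ν : ℝ)) /
                (4 * (l : ℝ) * (f : ℝ) ^ 2))) 0 hX0
    rw [mul_zero] at h0
    rw [← h0]
    have h1 : ∫ t in Set.Ioi (0:ℝ), G t * A t * e2 (-(v * t)) = J := by
      apply setIntegral_eq_integral_of_forall_compl_eq_zero
      intro t ht
      have : G t = 0 := by
        by_contra h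
        exact ht (TS (hs h))
      simp [this]
    rw [← h1, Complex.real_smul, ← integral_const_mul, ← integral_const_mul]
    apply setIntegral_congr_fun measurableSet_Ioi
    intro t ht
    have ht0 : (0:ℝ) < t := ht
    have hst : 0 < √t := Real.sqrt_pos.2 ht0
    have e1 : X * t / X = t := by field_simp
    have e2' : √(X * t) = r * √t := Real.sqrt_mul hX0.le t
    have e3 : (X * t) ^ ((α : ℝ) / 2) = X ^ ((α : ℝ) / 2) * t ^ ((α : ℝ) / 2) :=
      Real.mul_rpow hX0.le ht0.le
    have e4 : L / (2 * (r * √t) * q) = w * (√t)⁻¹ := by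
      rw [hw]; field_simp
    have e5 : e2 (-(2 * x * (ξ : ℝ) * (r * √t) + X * t * (ν : ℝ)) /
                (4 * (l : ℝ) * (f : ℝ) ^ 2)) = e2 (-(u * √t)) * e2 (-(v * t)) := by
      simp only [e2]
      rw [← Complex.exp_add, ← mul_add, ← Complex.ofReal_add]
      congr 3
      rw [hu, hv, hL]
      field_simp
      ring
    simp only [e1, e2', e3, e4, e5, hA, Complex.ofReal_mul]
    ring
  rw [hsub, norm_mul, Complex.norm_real, Real.norm_of_nonneg (by positivity)]
  have hXp : X ^ (1 + (α : ℝ) / 2) = X * X ^ ((α : ℝ) / 2) := by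
    rw [Real.rpow_add hX0, Real.rpow_one]
  have hXM : X ^ ((M : ℝ) / 2) = r ^ M := by
    rw [hrdef, Real.sqrt_eq_rpow, ← Real.rpow_natCast, ← Real.rpow_mul hX0.le]
    congr 1; ring
  rw [hXp, hXM]
  set S := sobolevNorm M G with hS
  have hS0 : 0 ≤ S := Finset.sum_nonneg (fun j _ => integral_nonneg (fun t => norm_nonneg _))
  set P : ℝ := L / r with hP
  have hP0 : 0 < P := by positivity
  have hvabs : |v| = |(ν:ℝ)| * r / (4 * P) := by
    rw [hv, abs_div, abs_mul, abs_of_pos hX0, abs_of_pos (by positivity : 0 < 4 * L), hP, hrX]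
    field_simp
  have hv0 : 0 < |v| := by rw [hvabs]; positivity
  have hwinv : w⁻¹ = 2 * (r * q / L) := by
    rw [hw]; field_simp
  have hPu : P * (1 + |u|) ≤ P + |(ξ:ℝ)| := by
    have hxa : |x| ≤ 1 := abs_le.2 ⟨hx.1.le, hx.2.le⟩
    have : P * |u| = |x| * |(ξ:ℝ)| / 2 := by
      rw [hu, abs_div, abs_mul, abs_mul, abs_of_pos hr, abs_of_pos (by positivity : 0 < 2 * L), hP]
      field_simp
    have h2 : |x| * |(ξ:ℝ)| ≤ 1 * |(ξ:ℝ)| := by gcongr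
    have h3 := abs_nonneg (ξ:ℝ)
    rw [mul_add, mul_one, this]
    linarith
  have hpow : (P * (1 + |u|)) ^ M ≤ 2 ^ M * (P ^ M + |(ξ:ℝ)| ^ M) := by
    calc _ ≤ (P + |(ξ:ℝ)|) ^ M := by gcongr
      _ ≤ 2 ^ (M - 1) * (P ^ M + |(ξ:ℝ)| ^ M) := add_pow_le hP0.le (abs_nonneg _) M
      _ ≤ _ := by
        gcongr
        · norm_num
        · omega
  have hJ1 : |v| ^ M * ‖J‖ ≤ 2 ^ M * K * S := by
    refine le_trans ?_ hFB
    gcongr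
    nlinarith [Real.pi_gt_three]
  have hJ2 : ‖J‖ ≤ 2 ^ M * K * S / |v| ^ M := by
    rw [le_div_iff₀ (by positivity)]; linarith
  have hJ3 : 2 ^ M * K * S / |v| ^ M = 2 ^ M * 4 ^ M * 2 ^ M * 2 ^ M * Ka * Cp * 2 ^ N * Ce * S *
      (1 / (|(ν:ℝ)| ^ M * r ^ M)) * (P * (1 + |u|)) ^ M * (r * q / L) ^ N := by
    rw [hK, hwinv, hvabs]
    clear_value P u
    simp only [mul_pow, div_pow]
    field_simp
  rw [hJ3] at hJ2
  have hJ4 : ‖J‖ ≤ 2 ^ M * 4 ^ M * 2 ^ M * 2 ^ M * Ka * Cp * 2 ^ N * Ce * S *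
      (1 / (|(ν:ℝ)| ^ M * r ^ M)) * (2 ^ M * (P ^ M + |(ξ:ℝ)| ^ M)) * (r * q / L) ^ N := by
    refine hJ2.trans ?_
    gcongr
  calc _ ≤ X * X ^ ((α : ℝ) / 2) * (2 ^ M * 4 ^ M * 2 ^ M * 2 ^ M * Ka * Cp * 2 ^ N * Ce * S *
      (1 / (|(ν:ℝ)| ^ M * r ^ M)) * (2 ^ M * (P ^ M + |(ξ:ℝ)| ^ M)) * (r * q / L) ^ N) := by
        gcongr
    _ = _ := by ring
end
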